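/- arXiv:1008.1865 — 11 statements merged into one kernel-verified Lean document; each statement's English description precedes it below -/
import Mathlib

section
/- Let G = (V,E) be a finite graph that is an (R,c)-expander, and let U ⊆ V be a set of vertices such that no two distinct vertices of U have a common neighbor in G. Then the induced subgraph G[V∖U] is an (R, c−1)-expander. -/
open SimpleGraph

/-- External neighborhood of a vertex set `U`: all vertices outside `U`
with at least one neighbor in `U`. -/
def extNbhd {V : Type*} (G : SimpleGraph V) (U : Set V) : Set V :=
  {v | v ∉ U ∧ ∃ u ∈ U, G.Adj u v}

/-- `G` is an `(R,c)`-expander: every vertex set of size at most `R`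
has external neighborhood of size at least `c` times its own size. -/
def IsExpander {V : Type*} (G : SimpleGraph V) (R c : ℝ) : Prop :=
  ∀ U : Set V, (U.ncard : ℝ) ≤ R → c * (U.ncard : ℝ) ≤ ((extNbhd G U).ncard : ℝ)

/-- If no two distinct vertices of `U` have a common neighbor, then a set `S` has at most `|S|`
external neighbors in `U`. -/
theorem ncard_extNbhd_inter_le {V : Type*} [Finite V] (G : SimpleGraph V) {U : Set V}
    (hU : ∀ u ∈ U, ∀ v ∈ U, u ≠ v → ∀ w : V, ¬(G.Adj u w ∧ G.Adj v w)) (S : Set V) :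
    (extNbhd G S ∩ U).ncard ≤ S.ncard := by
  have h : ∀ u ∈ extNbhd G S ∩ U, ∃ s ∈ S, G.Adj s u := fun u hu => hu.1.2
  choose! f hfS hf using h
  refine Set.ncard_le_ncard_of_injOn f hfS (fun u hu v hv huv => ?_) S.toFinite
  by_contra hne
  exact hU u hu.2 v hv.2 hne (f u) ⟨(hf u hu).symm, huv ▸ (hf v hv).symm⟩

/-- External neighbors outside `U` of a set disjoint from `U` are external neighbors in the
subgraph induced on the complement of `U`. -/
theorem extNbhd_image_val_diff_subset {V : Type*} (G : SimpleGraph V) (U : Set V)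
    (W : Set ↥Uᶜ) :
    extNbhd G (Subtype.val '' W) \ U ⊆ Subtype.val '' extNbhd (G.induce Uᶜ) W := by
  rintro v ⟨⟨hvW, _, ⟨w, hw, rfl⟩, hadj⟩, hvU⟩
  exact ⟨⟨v, hvU⟩, ⟨fun h => hvW ⟨_, h, rfl⟩, w, hw, hadj⟩, rfl⟩

/-- If `G` is an `(R,c)`-expander and `U` is a set of vertices no two
distinct members of which have a common neighbor in `G`, then the subgraph induced on the
complement of `U` is an `(R, c-1)`-expander. -/
theorem stmt3 {V : Type*} [Fintype V] (G : SimpleGraph V) (R : ℝ) (c : ℝ)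
    (hR : 0 < R) (hc : 0 < c) (hG : IsExpander G R c) (U : Set V)
    (hU : ∀ u ∈ U, ∀ v ∈ U, u ≠ v → ∀ w : V, ¬(G.Adj u w ∧ G.Adj v w)) :
    IsExpander (G.induce Uᶜ) R (c - 1) := by
  intro W hW
  have hcard : (Subtype.val '' W).ncard = W.ncard :=
    Set.ncard_image_of_injective W Subtype.val_injective
  have hexp := hG (Subtype.val '' W) (by rwa [hcard])
  have hin := ncard_extNbhd_inter_le G hU (Subtype.val '' W)
  have hout := Set.ncard_le_ncard (extNbhd_image_val_diff_subset G U W) (Set.toFinite _)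
  rw [Set.ncard_image_of_injective _ Subtype.val_injective] at hout
  have hsplit := Set.ncard_inter_add_ncard_sdiff_eq_ncard (extNbhd G (Subtype.val '' W)) U
    (Set.toFinite _)
  rw [hcard] at hexp hin
  have hle : ((extNbhd G (Subtype.val '' W)).ncard : ℝ) ≤
      W.ncard + (extNbhd (G.induce Uᶜ) W).ncard := by
    exact_mod_cast (by omega)
  linarith
end

section
/- Let G = (V,E) be a finite graph, let c > 0, let R > 0, and let U ⊆ V be a set of vertices such that every u ∈ U has degree d_G(u) ≥ c−1 in G, and such that G contains no path of length at most 4 (with at least one edge) whose two, possibly identical, endpoints both lie in U. If the induced subgraph G[V∖U] is an (R,c)-expander, then G is an (R, c−1)-expander. -/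
open SimpleGraph

section

variable {V : Type*} {G : SimpleGraph V} {U : Set V}

lemma four_lt_length_of_ne
    (hpath : ∀ u ∈ U, ∀ w ∈ U, ∀ p : G.Walk u w, p.IsPath → 0 < p.length → 4 < p.length)
    {u w : V} (hu : u ∈ U) (hw : w ∈ U) (hne : u ≠ w) (p : G.Walk u w) : 4 < p.length := by
  classical
  have hpos : 0 < p.bypass.length :=
    Nat.pos_of_ne_zero fun h ↦ hne (Walk.eq_of_length_eq_zero h)
  exact (hpath u hu w hw _ p.bypass_isPath hpos).trans_le p.length_bypass_le_length

lemma not_adj_of_mem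
    (hpath : ∀ u ∈ U, ∀ w ∈ U, ∀ p : G.Walk u w, p.IsPath → 0 < p.length → 4 < p.length)
    {u w : V} (hu : u ∈ U) (hw : w ∈ U) : ¬ G.Adj u w := fun h ↦ by
  have := four_lt_length_of_ne hpath hu hw h.ne (.cons h .nil)
  simp at this

lemma eq_of_adj_of_adj
    (hpath : ∀ u ∈ U, ∀ w ∈ U, ∀ p : G.Walk u w, p.IsPath → 0 < p.length → 4 < p.length)
    {u w x : V} (hu : u ∈ U) (hw : w ∈ U) (hux : G.Adj u x) (hwx : G.Adj w x) : u = w := by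
  by_contra hne
  have := four_lt_length_of_ne hpath hu hw hne (.cons hux (.cons hwx.symm .nil))
  simp at this

lemma no_triangle
    (hcycle : ∀ u ∈ U, ∀ p : G.Walk u u, p.IsCycle → 4 < p.length)
    {u x y : V} (hu : u ∈ U) (hux : G.Adj u x) (huy : G.Adj u y) : ¬ G.Adj x y := fun hxy ↦ by
  have := hcycle u hu (.cons hux (.cons hxy (.cons huy.symm .nil))) (by
    have := hux.ne
    have := huy.ne
    have := hxy.ne
    simp [Walk.cons_isCycle_iff]
    grind)
  simp at this

lemma no_quadrilateral
    (hcycle : ∀ u ∈ U, ∀ p : G.Walk u u, p.IsCycle → 4 < p.length)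
    {u x y b : V} (hu : u ∈ U) (hb : b ∉ U) (hux : G.Adj u x) (huy : G.Adj u y)
    (hxb : G.Adj x b) (hyb : G.Adj y b) : x = y := by
  by_contra hne
  have := hcycle u hu (.cons hux (.cons hxb (.cons hyb.symm (.cons huy.symm .nil)))) (by
    have : u ≠ b := fun h ↦ hb (h ▸ hu)
    have := hux.ne
    have := huy.ne
    have := hxb.ne
    have := hyb.ne
    simp [Walk.cons_isCycle_iff]
    grind)
  simp at this

/-- A vertex outside `U` has at most one neighbor of `U` in its closed neighborhood. -/
lemma eq_of_mem_closed_nbhd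
    (hpath : ∀ u ∈ U, ∀ w ∈ U, ∀ p : G.Walk u w, p.IsPath → 0 < p.length → 4 < p.length)
    (hcycle : ∀ u ∈ U, ∀ p : G.Walk u u, p.IsCycle → 4 < p.length)
    {u w x y b : V} (hu : u ∈ U) (hw : w ∈ U) (hb : b ∉ U) (hux : G.Adj u x) (hwy : G.Adj w y)
    (hx : x = b ∨ G.Adj b x) (hy : y = b ∨ G.Adj b y) : x = y := by
  obtain rfl | hne := eq_or_ne u w
  · rcases hx with rfl | hx <;> rcases hy with rfl | hy
    · rfl
    · exact (no_triangle hcycle hu hux hwy hy).elim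
    · exact (no_triangle hcycle hu hwy hux hx).elim
    · exact no_quadrilateral hcycle hu hb hux hwy hx.symm hy.symm
  · rcases hx with rfl | hx <;> rcases hy with rfl | hy
    · rfl
    · have := four_lt_length_of_ne hpath hu hw hne (.cons hux (.cons hy (.cons hwy.symm .nil)))
      simp at this
    · have := four_lt_length_of_ne hpath hu hw hne
        (.cons hux (.cons hx.symm (.cons hwy.symm .nil)))
      simp at this
    · have := four_lt_length_of_ne hpath hu hw hne
        (.cons hux (.cons hx.symm (.cons hy (.cons hwy.symm .nil))))
      simp at this

lemma mul_ncard_le_ncard_setOf_adj [Finite V] {d : ℝ} {A : Set V}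
    (hdeg : ∀ u ∈ A, d ≤ ((G.neighborSet u).ncard : ℝ))
    (hdisj : ∀ u ∈ A, ∀ w ∈ A, ∀ x, G.Adj u x → G.Adj w x → u = w) :
    d * (A.ncard : ℝ) ≤ ({x | ∃ u ∈ A, G.Adj u x}.ncard : ℝ) := by
  classical
  have := Fintype.ofFinite V
  have hset : {x | ∃ u ∈ A, G.Adj u x} = ↑(A.toFinset.biUnion fun u ↦ G.neighborFinset u) := by
    ext x
    simp
  rw [hset, Set.ncard_coe_finset, Finset.card_biUnion, Set.ncard_eq_toFinset_card', mul_comm,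
    ← nsmul_eq_mul, Nat.cast_sum]
  · refine Finset.card_nsmul_le_sum _ _ _ fun u hu ↦ ?_
    have := hdeg u (by simpa using hu)
    rwa [Set.ncard_eq_toFinset_card'] at this
  · intro u hu w hw hne
    refine Finset.disjoint_left.2 fun x hx hx' ↦ hne ?_
    exact hdisj u (by simpa using hu) w (by simpa using hw) x (by simpa using hx)
      (by simpa using hx')

lemma IsExpander.mul_ncard_le_of_induce {W : Set V} {R c : ℝ}
    (hexp : IsExpander (G.induce W) R c) {B : Set V} (hBW : B ⊆ W) (hB : (B.ncard : ℝ) ≤ R) :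
    c * (B.ncard : ℝ) ≤ ((extNbhd G B ∩ W).ncard : ℝ) := by
  have hcard : ((↑) ⁻¹' B : Set W).ncard = B.ncard :=
    Set.ncard_preimage_of_injective_subset_range Subtype.val_injective (by simpa using hBW)
  have himage : extNbhd G B ∩ W = (↑) '' extNbhd (G.induce W) ((↑) ⁻¹' B) := by
    ext x
    simp only [extNbhd, Set.mem_inter_iff, Set.mem_ofPred_eq, Set.mem_image, Set.mem_preimage,
      comap_adj, Function.Embedding.subtype_apply, Subtype.exists]
    grind
  rw [himage, Set.ncard_image_of_injective _ Subtype.val_injective, ← hcard]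
  exact hexp _ (by rwa [hcard])

end

/-- Let `U` be a set of vertices of `G` each of degree at least `c - 1`,
such that `G` has no path of length between `1` and `4` joining two distinct vertices of `U`
and no cycle of length at most `4` passing through a vertex of `U` (i.e. no "path" of
length at most `4` whose possibly identical endpoints lie in `U`).  If the subgraph induced
on the complement of `U` is an `(R,c)`-expander, then `G` is an `(R, c-1)`-expander. -/
theorem stmt4 {V : Type*} [Fintype V] (G : SimpleGraph V) (R : ℝ) (c : ℝ)
    (hR : 0 < R) (hc : 0 < c) (U : Set V)
    (hdeg : ∀ u ∈ U, (c : ℝ) - 1 ≤ ((G.neighborSet u).ncard : ℝ))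
    (hpath : ∀ u ∈ U, ∀ w ∈ U, ∀ p : G.Walk u w,
      p.IsPath → 0 < p.length → 4 < p.length)
    (hcycle : ∀ u ∈ U, ∀ p : G.Walk u u, p.IsCycle → 4 < p.length)
    (hexp : IsExpander (G.induce Uᶜ) R c) :
    IsExpander G R (c - 1) := by
  intro S hS
  set A := S ∩ U
  set B := S \ U
  set N := {x | ∃ u ∈ A, G.Adj u x}
  set P := extNbhd G B ∩ Uᶜ
  have hS_card : A.ncard + B.ncard = S.ncard := Set.ncard_inter_add_ncard_sdiff_eq_ncard S U
  have hP : c * (B.ncard : ℝ) ≤ (P.ncard : ℝ) :=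
    hexp.mul_ncard_le_of_induce (fun x hx ↦ hx.2)
      (le_trans (by exact_mod_cast Set.ncard_le_ncard Set.sdiff_subset) hS)
  have hN : (c - 1) * (A.ncard : ℝ) ≤ (N.ncard : ℝ) :=
    mul_ncard_le_ncard_setOf_adj (fun u hu ↦ hdeg u hu.2)
      fun u hu w hw x hux hwx ↦ eq_of_adj_of_adj hpath hu.2 hw.2 hux hwx
  have hnear : (N ∩ (B ∪ P)).ncard ≤ B.ncard := by
    have hex : ∀ x ∈ N ∩ (B ∪ P), ∃ b ∈ B, x = b ∨ G.Adj b x := by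
      rintro x ⟨-, hx | ⟨⟨-, b, hb, hbx⟩, -⟩⟩
      exacts [⟨x, hx, .inl rfl⟩, ⟨b, hb, .inr hbx⟩]
    choose! f hfB hf using hex
    refine Set.ncard_le_ncard_of_injOn f hfB fun x hx y hy hxy ↦ ?_
    obtain ⟨u, hu, hux⟩ := hx.1
    obtain ⟨w, hw, hwy⟩ := hy.1
    exact eq_of_mem_closed_nbhd hpath hcycle hu.2 hw.2 (hfB x hx).2 hux hwy (hf x hx)
      (hxy ▸ hf y hy)
  have hN_card : (N ∩ (B ∪ P)).ncard + (N \ (B ∪ P)).ncard = N.ncard :=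
    Set.ncard_inter_add_ncard_sdiff_eq_ncard N (B ∪ P)
  have hsub : P ∪ N \ (B ∪ P) ⊆ extNbhd G S := by
    rintro x (⟨⟨hxB, b, hb, hbx⟩, hxU⟩ | ⟨⟨u, hu, hux⟩, hx⟩)
    · exact ⟨fun hxS ↦ hxB ⟨hxS, hxU⟩, b, hb.1, hbx⟩
    · exact ⟨fun hxS ↦ hx (.inl ⟨hxS, fun hxU ↦ not_adj_of_mem hpath hu.2 hxU hux⟩), u, hu.1, hux⟩
  have hdisj : Disjoint P (N \ (B ∪ P)) :=
    Set.disjoint_left.2 fun x hx hx' ↦ hx'.2 (.inr hx)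
  have hle : P.ncard + (N \ (B ∪ P)).ncard ≤ (extNbhd G S).ncard :=
    Set.ncard_union_eq hdisj ▸ Set.ncard_le_ncard hsub
  rify at hS_card hnear hN_card hle
  rw [← hS_card]
  linarith
end

section
/- Let c > 0 and let G = (V,E) be a finite graph with minimum degree δ(G). Suppose there is a positive integer r with r ≤ |V|/(c+2) such that: (M1) e_G(U) ≤ δ(G)·|U|/(2(c+1)) for every subset U ⊆ V with 1 ≤ |U| < (c+1)·r, and (M2) e_G(U,W) > 0 for every pair of disjoint subsets U, W ⊆ V with |U| = |W| = r. Then G is an ((|V|−r)/(c+1), c)-expander. -/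
open SimpleGraph

/-- The number of edges of `G` with both endpoints in `U`. -/
noncomputable def edgesIn {V : Type*} (G : SimpleGraph V) (U : Set V) : ℕ :=
  {e ∈ G.edgeSet | ∀ v ∈ e, v ∈ U}.ncard

/-- The number of edges of `G` with one endpoint in `U` and the other in `W`. -/
noncomputable def edgesBetween {V : Type*} (G : SimpleGraph V) (U W : Set V) : ℕ :=
  {e ∈ G.edgeSet | ∃ u ∈ U, ∃ w ∈ W, e = s(u, w)}.ncard

/-- The minimum degree of a graph. -/
noncomputable def minDeg {V : Type*} (G : SimpleGraph V) : ℕ :=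
  ⨅ v : V, (G.neighborSet v).ncard

theorem minDeg_le_ncard_neighborSet {V : Type*} (G : SimpleGraph V) (v : V) :
    minDeg G ≤ (G.neighborSet v).ncard :=
  ciInf_le (OrderBot.bddBelow _) v

/-- Every edge meeting `U` lies inside `U ∪ extNbhd G U`, and is counted at most twice
by the degrees of the vertices of `U`. -/
theorem minDeg_mul_ncard_le_two_mul_edgesIn {V : Type*} [Finite V] (G : SimpleGraph V)
    (U : Set V) : minDeg G * U.ncard ≤ 2 * edgesIn G (U ∪ extNbhd G U) := by
  classical
  have := Fintype.ofFinite V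
  set P : Finset (Σ _ : V, V) := U.toFinset.sigma fun u => G.neighborFinset u with hP
  set f : (Σ _ : V, V) → Sym2 V := fun p => s(p.1, p.2)
  have lower : minDeg G * U.ncard ≤ P.card := by
    rw [hP, Finset.card_sigma, Set.ncard_eq_toFinset_card', mul_comm, ← smul_eq_mul]
    refine Finset.card_nsmul_le_sum _ _ _ fun u _ => ?_
    have h := minDeg_le_ncard_neighborSet G u
    rwa [Set.ncard_eq_toFinset_card'] at h
  have fibers : P.card ≤ 2 * (P.image f).card := by
    refine Finset.card_le_mul_card_image _ _ fun e _ => ?_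
    induction e with
    | _ a b =>
      refine (Finset.card_le_card (t := {⟨a, b⟩, ⟨b, a⟩}) ?_).trans Finset.card_le_two
      rintro ⟨x, y⟩ h
      have hxy : s(x, y) = s(a, b) := (Finset.mem_filter.mp h).2
      rcases Sym2.eq_iff.mp hxy with ⟨rfl, rfl⟩ | ⟨rfl, rfl⟩ <;> simp
  have upper : (P.image f).card ≤ edgesIn G (U ∪ extNbhd G U) := by
    rw [edgesIn, ← Set.ncard_coe_finset]
    refine Set.ncard_le_ncard ?_ (Set.toFinite _)
    intro e he
    obtain ⟨⟨u, v⟩, hp, rfl⟩ := Finset.mem_image.mp (Finset.mem_coe.mp he)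
    have hu : u ∈ U := by simpa using (Finset.mem_sigma.mp hp).1
    have huv : G.Adj u v := by simpa using (Finset.mem_sigma.mp hp).2
    refine ⟨huv, fun w hw => ?_⟩
    rcases Sym2.mem_iff.mp hw with rfl | rfl
    · exact Or.inl hu
    · by_cases hv : w ∈ U
      · exact Or.inl hv
      · exact Or.inr ⟨hv, u, hu, huv⟩
  omega

theorem exists_adj_of_edgesBetween_pos {V : Type*} {G : SimpleGraph V} {U W : Set V}
    (h : 0 < edgesBetween G U W) : ∃ u ∈ U, ∃ w ∈ W, G.Adj u w := by
  obtain ⟨e, he, u, hu, w, hw, rfl⟩ := Set.nonempty_of_ncard_ne_zero h.ne'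
  exact ⟨u, hu, w, hw, he⟩

theorem edgesIn_pair_pos {V : Type*} {G : SimpleGraph V} {u w : V} (h : G.Adj u w) :
    0 < edgesIn G {u, w} := by
  have hfin : {e ∈ G.edgeSet | ∀ v ∈ e, v ∈ ({u, w} : Set V)}.Finite := by
    refine (Set.finite_singleton s(u, w)).subset ?_
    rintro e ⟨he, hsub⟩
    induction e with
    | _ a b =>
      have hab : a ≠ b := G.ne_of_adj he
      have ha := hsub a (by simp)
      have hb := hsub b (by simp)
      simp only [Set.mem_insert_iff, Set.mem_singleton_iff] at ha hb
      rcases ha with rfl | rfl <;> rcases hb with rfl | rfl <;> simp_all [Sym2.eq_swap]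
  exact (Set.ncard_pos hfin).mpr ⟨s(u, w), h, by simp⟩

theorem ncard_union_extNbhd {V : Type*} [Finite V] (G : SimpleGraph V) (U : Set V) :
    (U ∪ extNbhd G U).ncard = U.ncard + (extNbhd G U).ncard :=
  Set.ncard_union_eq (Set.disjoint_left.mpr fun _ hv h => h.1 hv)
    (Set.toFinite _) (Set.toFinite _)

theorem not_adj_of_notMem_union_extNbhd {V : Type*} {G : SimpleGraph V} {U : Set V} {u w : V}
    (hu : u ∈ U) (hw : w ∉ U ∪ extNbhd G U) : ¬ G.Adj u w :=
  fun h => hw (Or.inr ⟨fun hwU => hw (Or.inl hwU), u, hu, h⟩)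

/-- If `c > 0`, `r` is a positive integer with `r ≤ |V|/(c+2)`, and
(M1) `e_G(U) ≤ δ(G)·|U| / (2(c+1))` for every vertex set `U` with `1 ≤ |U| < (c+1)r`, and
(M2) `e_G(U,W) > 0` for every pair of disjoint vertex sets of size `r` each,
then `G` is a `((|V|-r)/(c+1), c)`-expander. -/
theorem stmt5 {V : Type*} [Fintype V] (G : SimpleGraph V) (c : ℝ) (hc : 0 < c)
    (r : ℕ) (hr : 0 < r) (hrV : (r : ℝ) ≤ (Fintype.card V : ℝ) / (c + 2))
    (hM1 : ∀ U : Set V, 1 ≤ U.ncard → (U.ncard : ℝ) < (c + 1) * r →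
      (edgesIn G U : ℝ) ≤ (minDeg G : ℝ) * (U.ncard : ℝ) / (2 * (c + 1)))
    (hM2 : ∀ U W : Set V, Disjoint U W → U.ncard = r → W.ncard = r →
      0 < edgesBetween G U W) :
    IsExpander G (((Fintype.card V : ℝ) - r) / (c + 1)) c := by
  intro U hU
  by_contra! hlt
  have hcard := ncard_union_extNbhd G U
  have hcompl := Set.ncard_add_ncard_compl (U ∪ extNbhd G U)
  rw [Nat.card_eq_fintype_card] at hcompl
  have hcardR : ((U ∪ extNbhd G U).ncard : ℝ) = U.ncard + (extNbhd G U).ncard := by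
    exact_mod_cast hcard
  have hcomplR : ((U ∪ extNbhd G U).ncard : ℝ) + (U ∪ extNbhd G U)ᶜ.ncard
      = Fintype.card V := by
    exact_mod_cast hcompl
  rw [le_div_iff₀ (by positivity)] at hU hrV
  rcases le_or_gt r U.ncard with hrU | hUr
  · have hrest : r ≤ (U ∪ extNbhd G U)ᶜ.ncard := by
      have : (r : ℝ) ≤ (U ∪ extNbhd G U)ᶜ.ncard := by linarith
      exact_mod_cast this
    obtain ⟨A, hAU, hA⟩ := Set.exists_subset_card_eq hrU
    obtain ⟨B, hBU, hB⟩ := Set.exists_subset_card_eq hrest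
    obtain ⟨a, ha, b, hb, hab⟩ := exists_adj_of_edgesBetween_pos
      (hM2 A B (Set.disjoint_left.mpr fun x hxA hxB => hBU hxB (Or.inl (hAU hxA))) hA hB)
    exact not_adj_of_notMem_union_extNbhd (hAU ha) (hBU hb) hab
  · have hUpos : 0 < U.ncard := by
      have : (0 : ℝ) < U.ncard :=
        pos_of_mul_pos_right ((Nat.cast_nonneg _).trans_lt hlt) hc.le
      exact_mod_cast this
    have hUrR : (U.ncard : ℝ) < r := by exact_mod_cast hUr
    have hsmall : ((U ∪ extNbhd G U).ncard : ℝ) < (c + 1) * U.ncard := by linarith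
    rcases Nat.eq_zero_or_pos (minDeg G) with hδ | hδ
    · have hr2 : (2 : ℝ) ≤ r := by
        have : 2 ≤ r := by omega
        exact_mod_cast this
      have h2r : 2 * r ≤ (Set.univ : Set V).ncard := by
        rw [Set.ncard_univ, Nat.card_eq_fintype_card]
        have : (2 : ℝ) * r ≤ Fintype.card V := by nlinarith
        exact_mod_cast this
      obtain ⟨A, -, hA⟩ := Set.exists_subset_card_eq (s := (Set.univ : Set V)) (n := r) (by omega)
      obtain ⟨B, hBA, hB⟩ := Set.exists_subset_card_eq (s := Aᶜ) (n := r) (by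
        have := Set.ncard_add_ncard_compl A
        rw [Set.ncard_univ] at h2r
        omega)
      obtain ⟨a, -, b, -, hab⟩ := exists_adj_of_edgesBetween_pos
        (hM2 A B (Set.disjoint_left.mpr fun x hxA hxB => hBA hxB hxA) hA hB)
      have hpair : ({a, b} : Set V).ncard = 2 := Set.ncard_pair hab.ne
      have h := hM1 {a, b} (by omega) (by rw [hpair]; push_cast; nlinarith)
      have hpos : (0 : ℝ) < edgesIn G {a, b} := by exact_mod_cast edgesIn_pair_pos hab
      rw [hδ, Nat.cast_zero, zero_mul, zero_div] at h
      linarith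
    · have h := hM1 (U ∪ extNbhd G U) (by omega) (hsmall.trans (by gcongr))
      rw [le_div_iff₀ (by positivity)] at h
      have hcount : (minDeg G : ℝ) * U.ncard ≤ 2 * edgesIn G (U ∪ extNbhd G U) := by
        exact_mod_cast minDeg_mul_ncard_le_two_mul_edgesIn G U
      have hδR : (0 : ℝ) < minDeg G := by exact_mod_cast hδ
      have hstrict := mul_lt_mul_of_pos_left hsmall hδR
      have hscaled := mul_le_mul_of_nonneg_right hcount (by positivity : 0 ≤ c + 1)
      linarith
end

section
/- There exists a positive integer n0 such that the following holds. Let G' = (V,E) be a graph on n' ≥ n0 vertices with minimum degree δ(G') > 0, let ε satisfy 1/(2δ(G')) < ε < 1/2, and let r be an integer with 0 < r ≤ n'/e^4. Suppose that e_{G'}(U,W) ≥ (n'/(1−2ε))·ln(n'/r) for every pair of disjoint subsets U, W ⊆ V with |U| = |W| = r. Then E can be partitioned into two disjoint sets E = E1 ∪ E2 such that the graph G1 = (V,E1) has minimum degree δ(G1) ≥ ε·δ(G'), and the graph G2 = (V,E2) satisfies e_{G2}(U,W) ≥ 3r·ln(n'/r) for every pair of disjoint subsets U, W ⊆ V with |U|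 = |W| = r. -/
open SimpleGraph Real

/-- Random halving of a finite set `N`: there is a finite probability space of subsets of `N` of size
at most `#N / 2` which, off an exceptional set of at most one element, satisfies the same upper bound
on multiplicative functionals as independent fair coin tosses. -/
theorem exists_random_half {α : Type*} [DecidableEq α] (N : Finset α) :
    ∃ (Ω : Type) (_ : Fintype Ω) (_ : Nonempty Ω) (S : Ω → Finset α) (Z : Finset α),
      (∀ ω, S ω ⊆ N) ∧ (∀ ω, 2 * (S ω).card ≤ N.card) ∧ Z ⊆ N ∧ Z.card ≤ 1 ∧
      ∀ x : α → ℝ, (∀ a, 0 ≤ x a) → (∀ a, x a ≤ 1) →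
        ∑ ω, ∏ a ∈ S ω, x a ≤ Fintype.card Ω * ∏ a ∈ N \ Z, (1 + x a) / 2 := by
  induction N using Finset.strongInduction with
  | H N ih =>
    by_cases hN : N.card ≤ 1
    · exact ⟨Unit, inferInstance, inferInstance, fun _ => ∅, N, by simp, by simp, subset_rfl, hN,
        by simp⟩
    obtain ⟨a, ha, b, hb, hab⟩ := Finset.one_lt_card.1 (not_le.1 hN)
    set M := (N.erase a).erase b with hM
    have hbe : b ∈ N.erase a := Finset.mem_erase.2 ⟨hab.symm, hb⟩
    have hMN : insert a (insert b M) = N := by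
      rw [hM, Finset.insert_erase hbe, Finset.insert_erase ha]
    have haM : a ∉ M := by simp [hM]
    have hbM : b ∉ M := by simp [hM]
    have hcard : N.card = M.card + 2 := by
      rw [← hMN, Finset.card_insert_of_notMem (by simp [hab, haM]),
        Finset.card_insert_of_notMem hbM]
    have hss : M ⊂ N := by
      refine Finset.ssubset_iff_subset_ne.2 ⟨?_, fun h => haM (h ▸ ha)⟩
      exact (Finset.erase_subset _ _).trans (Finset.erase_subset _ _)
    obtain ⟨Ω, _, _, S, Z, hS, hcS, hZ, hcZ, hx⟩ := ih M hss
    refine ⟨Ω × Bool, inferInstance, inferInstance,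
      fun p => insert (if p.2 then a else b) (S p.1), Z, ?_, ?_, hZ.trans hss.1, hcZ, ?_⟩
    · rintro ⟨ω, c⟩
      refine Finset.insert_subset ?_ ((hS ω).trans hss.1)
      cases c <;> simp [ha, hb]
    · rintro ⟨ω, c⟩
      have := Finset.card_insert_le (if c then a else b) (S ω)
      have := hcS ω
      simp only
      omega
    · intro x h0 h1
      have haS : ∀ ω, a ∉ S ω := fun ω h => haM (hS ω h)
      have hbS : ∀ ω, b ∉ S ω := fun ω h => hbM (hS ω h)
      have haZ : a ∉ Z := fun h => haM (hZ h)
      have hbZ : b ∉ Z := fun h => hbM (hZ h)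
      have hNZ : N \ Z = insert a (insert b (M \ Z)) := by
        rw [← hMN, Finset.insert_sdiff_of_notMem _ haZ, Finset.insert_sdiff_of_notMem _ hbZ]
      rw [hNZ, Finset.prod_insert (by simp [hab, haM]), Finset.prod_insert (by simp [hbM]),
        Fintype.sum_prod_type]
      simp only [Fintype.sum_bool, if_true, Bool.false_eq_true, if_false,
        Finset.prod_insert (haS _), Finset.prod_insert (hbS _), ← add_mul, ← Finset.mul_sum]
      have key : x a + x b ≤ 2 * ((1 + x a) / 2 * ((1 + x b) / 2)) := by
        nlinarith [mul_nonneg (sub_nonneg.2 (h1 a)) (sub_nonneg.2 (h1 b))]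
      have hP : 0 ≤ ∏ c ∈ M \ Z, (1 + x c) / 2 :=
        Finset.prod_nonneg fun c _ => by linarith [h0 c]
      calc (x a + x b) * ∑ ω, ∏ c ∈ S ω, x c
          ≤ (x a + x b) * (Fintype.card Ω * ∏ c ∈ M \ Z, (1 + x c) / 2) :=
            mul_le_mul_of_nonneg_left (hx x h0 h1) (add_nonneg (h0 a) (h0 b))
        _ ≤ (2 * ((1 + x a) / 2 * ((1 + x b) / 2))) *
              (Fintype.card Ω * ∏ c ∈ M \ Z, (1 + x c) / 2) :=
            mul_le_mul_of_nonneg_right key (by positivity)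
        _ = _ := by
            rw [Fintype.card_prod, Fintype.card_bool]
            push_cast
            ring

/-- The pairs `(u, w) ∈ U × W` that are selected from both sides by `P` and `Q`. -/
def mutualPairs {V : Type*} [DecidableEq V] (P Q : V → Finset V) (U W : Finset V) :
    Finset (V × V) :=
  (U ×ˢ W).filter fun p => p.2 ∈ P p.1 ∧ p.1 ∈ Q p.2

theorem card_mutualPairs_swap {V : Type*} [DecidableEq V] (P Q : V → Finset V) (U W : Finset V) :
    (mutualPairs P Q U W).card = (mutualPairs Q P W U).card := by
  refine Finset.card_nbij' Prod.swap Prod.swap ?_ ?_ ?_ ?_ <;> rintro ⟨a, b⟩ <;>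
    simp [mutualPairs] <;> tauto

theorem prod_prod_ite_eq_pow {V : Type*} [Fintype V] [DecidableEq V] (P Q : V → Finset V)
    (U W : Finset V) (c : ℝ) :
    ∏ u ∈ U, ∏ w ∈ P u, (if w ∈ W ∧ u ∈ Q w then c else 1) =
      c ^ (mutualPairs P Q U W).card := by
  have h1 : c ^ (mutualPairs P Q U W).card =
      ∏ p ∈ U ×ˢ W, if p.2 ∈ P p.1 ∧ p.1 ∈ Q p.2 then c else 1 := by
    rw [Finset.prod_ite, Finset.prod_const_one, mul_one, Finset.prod_const, mutualPairs]
  rw [h1, Finset.prod_product]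
  refine Finset.prod_congr rfl fun u _ => ?_
  rw [← Finset.prod_filter, ← Finset.prod_filter]
  refine Finset.prod_congr ?_ fun _ _ => rfl
  ext w
  simp only [Finset.mem_filter]
  tauto

section RandomSelection

variable {V : Type*} [Fintype V] [DecidableEq V] {Ω : V → Type} [∀ v, Fintype (Ω v)]

theorem sum_prod_prod_le {S : ∀ v, Ω v → Finset V} {T : V → Finset V}
    (h : ∀ v, ∀ x : V → ℝ, (∀ a, 0 ≤ x a) → (∀ a, x a ≤ 1) →
      ∑ ω, ∏ a ∈ S v ω, x a ≤ Fintype.card (Ω v) * ∏ a ∈ T v, (1 + x a) / 2)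
    (A : Finset V) {x : V → V → ℝ} (h0 : ∀ v a, 0 ≤ x v a) (h1 : ∀ v a, x v a ≤ 1) :
    ∑ ω : ∀ v, Ω v, ∏ v ∈ A, ∏ a ∈ S v (ω v), x v a ≤
      Fintype.card (∀ v, Ω v) * ∏ v ∈ A, ∏ a ∈ T v, (1 + x v a) / 2 := by
  have e1 : ∀ ω : ∀ v, Ω v, ∏ v ∈ A, ∏ a ∈ S v (ω v), x v a =
      ∏ v, (if v ∈ A then ∏ a ∈ S v (ω v), x v a else 1) := fun ω => by
    rw [Finset.prod_ite_mem, Finset.univ_inter]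
  have e2 : ∏ v ∈ A, ∏ a ∈ T v, (1 + x v a) / 2 =
      ∏ v, (if v ∈ A then ∏ a ∈ T v, (1 + x v a) / 2 else 1) := by
    rw [Finset.prod_ite_mem, Finset.univ_inter]
  simp only [e1]
  rw [e2, Fintype.card_pi, Nat.cast_prod, ← Finset.prod_mul_distrib,
    ← Fintype.prod_sum (fun v (w : Ω v) => if v ∈ A then ∏ a ∈ S v w, x v a else 1)]
  refine Finset.prod_le_prod (fun v _ => Finset.sum_nonneg fun w _ => ?_) fun v _ => ?_
  · split_ifs
    · exact Finset.prod_nonneg fun a _ => h0 v a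
    · exact zero_le_one
  · split_ifs
    · exact h v (x v) (h0 v) (h1 v)
    · simp

theorem card_mul_sum_eq_sum_sum_piecewise (U : Finset V) (F : (∀ v, Ω v) → ℝ) :
    (Fintype.card (∀ v, Ω v) : ℝ) * ∑ ω, F ω = ∑ ω', ∑ ω, F (U.piecewise ω ω') := by
  let f : (∀ v, Ω v) × (∀ v, Ω v) → (∀ v, Ω v) × (∀ v, Ω v) :=
    fun p => (U.piecewise p.1 p.2, U.piecewise p.2 p.1)
  have hf : Function.Involutive f := by
    rintro ⟨a, b⟩
    ext v <;> by_cases hv : v ∈ U <;> simp [f, hv]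
  rw [Finset.sum_comm, ← Fintype.sum_prod_type' (fun ω ω' => F (U.piecewise ω ω'))]
  have := Equiv.sum_comp hf.toPerm (fun p => F p.1)
  simp only [Function.Involutive.coe_toPerm, f] at this
  rw [this, Fintype.sum_prod_type]
  simp [Finset.mul_sum]

theorem sum_pow_card_mutualPairs_le [∀ v, Nonempty (Ω v)] {S : ∀ v, Ω v → Finset V}
    {T : V → Finset V}
    (h : ∀ v, ∀ x : V → ℝ, (∀ a, 0 ≤ x a) → (∀ a, x a ≤ 1) →
      ∑ ω, ∏ a ∈ S v ω, x a ≤ Fintype.card (Ω v) * ∏ a ∈ T v, (1 + x a) / 2)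
    {U W : Finset V} (hUW : Disjoint U W) {y : ℝ} (hy0 : 0 ≤ y) (hy1 : y ≤ 1) :
    ∑ ω : ∀ v, Ω v, y ^ (mutualPairs (fun v => S v (ω v)) (fun v => S v (ω v)) U W).card ≤
      Fintype.card (∀ v, Ω v) * ((3 + y) / 4) ^ (mutualPairs T T U W).card := by
  have half_ite : ∀ (p : Prop) [Decidable p] (c : ℝ),
      (1 + if p then c else 1) / 2 = if p then (1 + c) / 2 else 1 := by
    intro p _ c
    split_ifs <;> norm_num
  set C : ℝ := (Fintype.card (∀ v, Ω v) : ℝ) with hC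
  have hC0 : 0 < C := Nat.cast_pos.2 Fintype.card_pos
  have inner : ∀ ω' : ∀ v, Ω v,
      ∑ ω : ∀ v, Ω v, y ^ (mutualPairs (fun v => S v (U.piecewise ω ω' v))
        (fun v => S v (U.piecewise ω ω' v)) U W).card ≤
      C * ((1 + y) / 2) ^ (mutualPairs (fun v => S v (ω' v)) T W U).card := by
    intro ω'
    have e : ∀ ω : ∀ v, Ω v, mutualPairs (fun v => S v (U.piecewise ω ω' v))
        (fun v => S v (U.piecewise ω ω' v)) U W =
        mutualPairs (fun v => S v (ω v)) (fun v => S v (ω' v)) U W := by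
      intro ω
      refine Finset.filter_congr fun p hp => ?_
      rw [Finset.mem_product] at hp
      beta_reduce
      rw [Finset.piecewise_eq_of_mem _ _ _ hp.1,
        Finset.piecewise_eq_of_notMem _ _ _ (Finset.disjoint_right.1 hUW hp.2)]
    simp only [e, ← prod_prod_ite_eq_pow]
    refine (sum_prod_prod_le h U ?_ ?_).trans_eq ?_
    · intro v a
      split_ifs <;> linarith
    · intro v a
      split_ifs <;> linarith
    · simp only [half_ite]
      rw [prod_prod_ite_eq_pow T (fun v => S v (ω' v)), prod_prod_ite_eq_pow, card_mutualPairs_swap]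
  have outer : ∑ ω' : ∀ v, Ω v, ((1 + y) / 2) ^ (mutualPairs (fun v => S v (ω' v)) T W U).card ≤
      C * ((3 + y) / 4) ^ (mutualPairs T T U W).card := by
    simp only [← prod_prod_ite_eq_pow (fun v => S v _)]
    refine (sum_prod_prod_le h W ?_ ?_).trans_eq ?_
    · intro v a
      split_ifs <;> linarith
    · intro v a
      split_ifs <;> linarith
    · simp only [half_ite]
      rw [prod_prod_ite_eq_pow, card_mutualPairs_swap, hC]
      ring_nf
  refine le_of_mul_le_mul_left ?_ hC0
  rw [hC, card_mul_sum_eq_sum_sum_piecewise U, ← hC]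
  refine (Finset.sum_le_sum fun ω' _ => inner ω').trans ?_
  rw [← Finset.mul_sum]
  exact mul_le_mul_of_nonneg_left outer hC0.le

end RandomSelection

theorem edgesBetween_coe_eq_card {V : Type*} [DecidableEq V] (G : SimpleGraph V)
    [DecidableRel G.Adj] {U W : Finset V} (hUW : Disjoint U W) :
    edgesBetween G (U : Set V) W = ((U ×ˢ W).filter fun p => G.Adj p.1 p.2).card := by
  rw [edgesBetween, ← Set.ncard_coe_finset]
  symm
  refine Set.ncard_congr (fun p _ => s(p.1, p.2)) ?_ ?_ ?_
  · rintro ⟨u, w⟩ hp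
    simp only [Finset.coe_filter, Finset.mem_product, Set.mem_ofPred_eq] at hp
    exact ⟨hp.2, u, hp.1.1, w, hp.1.2, rfl⟩
  · rintro ⟨u, w⟩ ⟨u', w'⟩ hp hp' he
    simp only [Finset.coe_filter, Finset.mem_product, Set.mem_ofPred_eq] at hp hp'
    rcases Sym2.eq_iff.1 he with ⟨h1, h2⟩ | ⟨h1, h2⟩
    · exact Prod.ext h1 h2
    · simp only at h1
      exact absurd (h1 ▸ hp'.1.2) (Finset.disjoint_left.1 hUW hp.1.1)
  · rintro e ⟨he, u, hu, w, hw, rfl⟩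
    refine ⟨(u, w), ?_, rfl⟩
    simp only [Finset.coe_filter, Finset.mem_product, Set.mem_ofPred_eq]
    exact ⟨⟨hu, hw⟩, he⟩

/-- Deleting at most one element from each selection destroys at most `#U + #W` mutual pairs. -/
theorem card_mutualPairs_le_card_mutualPairs_sdiff {V : Type*} [DecidableEq V]
    (N Z : V → Finset V) (hZ : ∀ v, (Z v).card ≤ 1) (U W : Finset V) :
    (mutualPairs N N U W).card ≤
      (mutualPairs (fun v => N v \ Z v) (fun v => N v \ Z v) U W).card + (U.card + W.card) := by
  have hsub : mutualPairs N N U W ⊆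
      mutualPairs (fun v => N v \ Z v) (fun v => N v \ Z v) U W ∪
        (U.biUnion (fun u => (Z u).image fun w => (u, w)) ∪
          W.biUnion (fun w => (Z w).image fun u => (u, w))) := by
    rintro ⟨u, w⟩ hp
    simp only [mutualPairs, Finset.mem_filter, Finset.mem_product, Finset.mem_union,
      Finset.mem_sdiff, Finset.mem_biUnion, Finset.mem_image, Prod.mk.injEq] at hp ⊢
    by_cases h1 : w ∈ Z u
    · exact Or.inr (Or.inl ⟨u, hp.1.1, w, h1, rfl, rfl⟩)
    by_cases h2 : u ∈ Z w
    · exact Or.inr (Or.inr ⟨w, hp.1.2, u, h2, rfl, rfl⟩)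
    · exact Or.inl ⟨hp.1, ⟨hp.2.1, h1⟩, hp.2.2, h2⟩
  have hU : (U.biUnion (fun u => (Z u).image fun w => (u, w))).card ≤ U.card * 1 :=
    Finset.card_biUnion_le_card_mul _ _ _ fun u _ => Finset.card_image_le.trans (hZ u)
  have hW : (W.biUnion (fun w => (Z w).image fun u => (u, w))).card ≤ W.card * 1 :=
    Finset.card_biUnion_le_card_mul _ _ _ fun u _ => Finset.card_image_le.trans (hZ u)
  have h1 := Finset.card_le_card hsub
  have h2 := Finset.card_union_le
    (mutualPairs (fun v => N v \ Z v) (fun v => N v \ Z v) U W)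
    (U.biUnion (fun u => (Z u).image fun w => (u, w)) ∪
          W.biUnion (fun w => (Z w).image fun u => (u, w)))
  have h3 := Finset.card_union_le (U.biUnion (fun u => (Z u).image fun w => (u, w)))
    (W.biUnion (fun w => (Z w).image fun u => (u, w)))
  omega

theorem choose_le_exp {n r : ℕ} (hr : 0 < r) (hn : 0 < n) :
    (n.choose r : ℝ) ≤ Real.exp (r * (1 + Real.log (n / r))) := by
  have hr' : (0 : ℝ) < r := Nat.cast_pos.2 hr
  have hn' : (0 : ℝ) < n := Nat.cast_pos.2 hn
  have h2 : (r : ℝ) ^ r / r.factorial ≤ Real.exp r := Real.pow_div_factorial_le_exp _ hr'.le r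
  calc (n.choose r : ℝ) ≤ (n : ℝ) ^ r / r.factorial := Nat.choose_le_pow_div r n
    _ = ((r : ℝ) ^ r / r.factorial) * ((n : ℝ) / r) ^ r := by
        rw [div_pow]
        field_simp
    _ ≤ Real.exp r * ((n : ℝ) / r) ^ r := mul_le_mul_of_nonneg_right h2 (by positivity)
    _ = Real.exp (r * (1 + Real.log (n / r))) := by
        rw [mul_add, mul_one, Real.exp_add, Real.exp_nat_mul, Real.exp_log (by positivity)]

theorem choose_sq_mul_pow_le {n r m : ℕ} (hr : 0 < r) (hrn : (r : ℝ) ≤ n / Real.exp 4)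
    (hm : n * Real.log (n / r) ≤ m + 2 * r) :
    ((n.choose r : ℝ) * n.choose r) * ((3 + Real.exp (-1)) / 4) ^ m ≤
      Real.exp (-(3 * r * Real.log (n / r))) := by
  have hr' : (0 : ℝ) < r := Nat.cast_pos.2 hr
  have hn4 : Real.exp 4 * r ≤ n := by
    rw [mul_comm]
    exact (le_div_iff₀ (Real.exp_pos 4)).1 hrn
  have hn' : (0 : ℝ) < n := lt_of_lt_of_le (by positivity) hn4
  have hn : 0 < n := Nat.cast_pos.1 hn'
  have he : (50 : ℝ) ≤ Real.exp 4 := by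
    have h1 : (2.7 : ℝ) ≤ Real.exp 1 := by linarith [Real.exp_one_gt_d9]
    have h2 : Real.exp 4 = Real.exp 1 ^ 4 := by
      rw [← Real.exp_nat_mul]
      norm_num
    rw [h2]
    calc (50 : ℝ) ≤ 2.7 ^ 4 := by norm_num
      _ ≤ _ := pow_le_pow_left₀ (by norm_num) h1 4
  have hL : 4 ≤ Real.log (n / r) := by
    rw [Real.le_log_iff_exp_le (by positivity)]
    exact (le_div_iff₀ hr').2 hn4
  set L := Real.log ((n : ℝ) / r) with hLdef
  have hq : (3 + Real.exp (-1)) / 4 ≤ Real.exp (-(1 / 8)) := by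
    have h1 : Real.exp (-1) ≤ 1 / 2 := by
      rw [Real.exp_neg, inv_le_comm₀ (Real.exp_pos 1) (by norm_num)]
      linarith [Real.exp_one_gt_d9]
    linarith [Real.add_one_le_exp (-(1 / 8) : ℝ)]
  have hqm : ((3 + Real.exp (-1)) / 4) ^ m ≤ Real.exp (m * -(1 / 8)) := by
    rw [Real.exp_nat_mul]
    exact pow_le_pow_left₀ (by positivity) hq m
  have hc := choose_le_exp hr hn
  calc ((n.choose r : ℝ) * n.choose r) * ((3 + Real.exp (-1)) / 4) ^ m
      ≤ (Real.exp (r * (1 + L)) * Real.exp (r * (1 + L))) * Real.exp (m * -(1 / 8)) := by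
        gcongr
    _ = Real.exp (r * (1 + L) + r * (1 + L) + m * -(1 / 8)) := by
        rw [Real.exp_add, Real.exp_add]
    _ ≤ _ := by
        refine Real.exp_le_exp.2 ?_
        have h1 : 50 * (r : ℝ) * L ≤ n * L :=
          mul_le_mul_of_nonneg_right
            ((mul_le_mul_of_nonneg_right he hr'.le).trans hn4) (by linarith)
        have h2 : 4 * (r : ℝ) ≤ r * L := by
          rw [mul_comm]
          exact mul_le_mul_of_nonneg_left hL hr'.le
        nlinarith

/-- A graph whose pairs of disjoint `r`-sets span many edges has a spanning subgraph, taking at most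
half of the edges at each vertex, whose pairs of disjoint `r`-sets still span many edges. -/
theorem exists_half_degree_subgraph {n r : ℕ} (G : SimpleGraph (Fin n)) [DecidableRel G.Adj]
    (hr : 0 < r) (hrn : (r : ℝ) ≤ n / Real.exp 4)
    (hG : ∀ U W : Finset (Fin n), Disjoint U W → U.card = r → W.card = r →
      n * Real.log (n / r) ≤ edgesBetween G (U : Set (Fin n)) W) :
    ∃ H : SimpleGraph (Fin n), H ≤ G ∧
      (∀ v, 2 * (H.neighborSet v).ncard ≤ (G.neighborSet v).ncard) ∧
      ∀ U W : Finset (Fin n), Disjoint U W → U.card = r → W.card = r →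
        3 * (r : ℝ) * Real.log (n / r) ≤ edgesBetween H (U : Set (Fin n)) W := by
  classical
  choose Ω instF instN S Z hSN hSc hZN hZc hx using
    fun v => exists_random_half (G.neighborFinset v)
  set L := Real.log ((n : ℝ) / r) with hL
  let X (ω : ∀ v, Ω v) (p : Finset (Fin n) × Finset (Fin n)) : ℕ :=
    (mutualPairs (fun v => S v (ω v)) (fun v => S v (ω v)) p.1 p.2).card
  let pairs : Finset (Finset (Fin n) × Finset (Fin n)) :=
    (Finset.powersetCard r Finset.univ ×ˢ Finset.powersetCard r Finset.univ).filter
      fun p => Disjoint p.1 p.2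
  obtain ⟨ω, hω⟩ : ∃ ω, ∀ p ∈ pairs, 3 * (r : ℝ) * L ≤ X ω p := by
    by_contra! hbad
    have hlow : Fintype.card (∀ v, Ω v) * Real.exp (-(3 * r * L)) <
        ∑ ω : ∀ v, Ω v, ∑ p ∈ pairs, Real.exp (-1) ^ X ω p := by
      rw [← nsmul_eq_mul, ← Finset.card_univ, ← Finset.sum_const]
      refine Finset.sum_lt_sum_of_nonempty Finset.univ_nonempty fun ω _ => ?_
      obtain ⟨p, hp, hlt⟩ := hbad ω
      refine lt_of_lt_of_le ?_ (Finset.single_le_sum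
        (f := fun p => Real.exp (-1) ^ X ω p) (fun _ _ => by positivity) hp)
      simp only [← Real.exp_nat_mul]
      exact Real.exp_lt_exp.2 (by linarith)
    have hup : ∑ ω : ∀ v, Ω v, ∑ p ∈ pairs, Real.exp (-1) ^ X ω p ≤
        Fintype.card (∀ v, Ω v) * Real.exp (-(3 * r * L)) := by
      rw [Finset.sum_comm]
      have hc0 : 0 < (n.choose r : ℝ) * n.choose r := by
        have : r ≤ n := by
          have h1 : (1 : ℝ) ≤ Real.exp 4 := Real.one_le_exp (by norm_num)
          exact_mod_cast hrn.trans (div_le_self (Nat.cast_nonneg n) h1)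
        have := Nat.choose_pos this
        positivity
      have hpc : (pairs.card : ℝ) ≤ (n.choose r : ℝ) * n.choose r := by
        have := Finset.card_filter_le
          ((Finset.powersetCard r (Finset.univ : Finset (Fin n))) ×ˢ
            Finset.powersetCard r (Finset.univ : Finset (Fin n))) (fun p => Disjoint p.1 p.2)
        rw [Finset.card_product, Finset.card_powersetCard, Finset.card_univ,
          Fintype.card_fin] at this
        exact_mod_cast this
      have hterm : ∀ p ∈ pairs, ∑ ω : ∀ v, Ω v, Real.exp (-1) ^ X ω p ≤
          Fintype.card (∀ v, Ω v) *
            (Real.exp (-(3 * r * L)) / ((n.choose r : ℝ) * n.choose r)) := by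
        rintro ⟨U, W⟩ hp
        simp only [pairs, Finset.mem_filter, Finset.mem_product, Finset.mem_powersetCard,
          Finset.subset_univ, true_and] at hp
        obtain ⟨⟨hU, hW⟩, hUW⟩ := hp
        refine (sum_pow_card_mutualPairs_le hx hUW (Real.exp_pos _).le
          (Real.exp_le_one_iff.2 (by norm_num))).trans ?_
        refine mul_le_mul_of_nonneg_left ?_ (Nat.cast_nonneg _)
        rw [le_div_iff₀' hc0]
        refine choose_sq_mul_pow_le hr hrn ?_
        refine (hG U W hUW hU hW).trans ?_
        have h1 := card_mutualPairs_le_card_mutualPairs_sdiff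
          (fun v => G.neighborFinset v) Z hZc U W
        have h2 : edgesBetween G (U : Set (Fin n)) W =
            (mutualPairs (fun v => G.neighborFinset v) (fun v => G.neighborFinset v) U W).card := by
          rw [edgesBetween_coe_eq_card G hUW, mutualPairs]
          congr 1
          refine Finset.filter_congr fun p _ => ?_
          simp [G.adj_comm p.2 p.1]
        rw [← h2, hU, hW, ← two_mul] at h1
        exact_mod_cast h1
      refine (Finset.sum_le_card_nsmul _ _ _ hterm).trans ?_
      rw [nsmul_eq_mul]
      refine (mul_le_mul_of_nonneg_right hpc (by positivity)).trans_eq ?_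
      rw [mul_left_comm, mul_div_cancel₀ _ hc0.ne']
    exact absurd hlow (not_lt.2 hup)
  let H : SimpleGraph (Fin n) :=
    { Adj := fun u w => w ∈ S u (ω u) ∧ u ∈ S w (ω w)
      symm := ⟨fun _ _ h => ⟨h.2, h.1⟩⟩
      loopless := ⟨fun v h => by
        have := hSN v _ h.1
        simp at this⟩ }
  refine ⟨H, fun u w h => (G.mem_neighborFinset u w).1 (hSN u _ h.1), fun v => ?_, ?_⟩
  · have h1 : (H.neighborSet v).ncard ≤ (S v (ω v)).card := by
      rw [← Set.ncard_coe_finset]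
      exact Set.ncard_le_ncard (fun w h => h.1) (Finset.finite_toSet _)
    have h2 : (G.neighborSet v).ncard = (G.neighborFinset v).card := by
      rw [← Set.ncard_coe_finset, G.coe_neighborFinset]
    have := hSc v (ω v)
    omega
  · intro U W hUW hU hW
    rw [edgesBetween_coe_eq_card H hUW]
    exact hω (U, W) (by simp [pairs, hU, hW, hUW])

/-- For all large enough `n'`: if `G'` is a graph on `n'` vertices with
positive minimum degree `δ`, `1/(2δ) < ε < 1/2`, `r` is an integer with `0 < r ≤ n'/e⁴`,
and `e_{G'}(U,W) ≥ (n'/(1-2ε))·ln(n'/r)` for all disjoint `U, W` of size `r` each, then the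
edge set of `G'` can be partitioned as `E1 ∪ E2` so that `G1 = (V,E1)` has minimum degree at
least `ε·δ` and `G2 = (V,E2)` has `e_{G2}(U,W) ≥ 3r·ln(n'/r)` for all disjoint `U, W` of
size `r` each. -/
theorem stmt6 :
    ∃ n0 : ℕ, 0 < n0 ∧ ∀ n' : ℕ, n0 ≤ n' → ∀ G' : SimpleGraph (Fin n'),
      0 < minDeg G' →
      ∀ ε : ℝ, 1 / (2 * (minDeg G' : ℝ)) < ε → ε < 1 / 2 →
      ∀ r : ℕ, 0 < r → (r : ℝ) ≤ (n' : ℝ) / Real.exp 4 →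
      (∀ U W : Set (Fin n'), Disjoint U W → U.ncard = r → W.ncard = r →
        (n' : ℝ) / (1 - 2 * ε) * Real.log ((n' : ℝ) / (r : ℝ)) ≤ (edgesBetween G' U W : ℝ)) →
      ∃ G1 G2 : SimpleGraph (Fin n'), G1 ⊔ G2 = G' ∧ G1 ⊓ G2 = ⊥ ∧
        ε * (minDeg G' : ℝ) ≤ (minDeg G1 : ℝ) ∧
        ∀ U W : Set (Fin n'), Disjoint U W → U.ncard = r → W.ncard = r →
          3 * (r : ℝ) * Real.log ((n' : ℝ) / (r : ℝ)) ≤ (edgesBetween G2 U W : ℝ) := by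
  classical
  refine ⟨1, one_pos, fun n hn G hδ ε hε0 hε1 r hr hrn hG => ?_⟩
  have hε : 0 < ε := lt_of_le_of_lt (by positivity) hε0
  have hr' : (0 : ℝ) < r := Nat.cast_pos.2 hr
  have hlog : 0 ≤ Real.log ((n : ℝ) / r) := by
    refine Real.log_nonneg ((one_le_div hr').2 (hrn.trans ?_))
    exact div_le_self (Nat.cast_nonneg n) (Real.one_le_exp (by norm_num))
  obtain ⟨H, hHG, hdeg, hH⟩ := exists_half_degree_subgraph G hr hrn fun U W hUW hU hW => by
    refine le_trans ?_ (hG U W (Finset.disjoint_coe.2 hUW) (by rwa [Set.ncard_coe_finset])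
      (by rwa [Set.ncard_coe_finset]))
    refine mul_le_mul_of_nonneg_right ?_ hlog
    exact le_div_self (Nat.cast_nonneg n) (by linarith) (by linarith)
  refine ⟨G \ H, H, sdiff_sup_cancel hHG, disjoint_iff.1 disjoint_sdiff_self_left, ?_, ?_⟩
  · have : Nonempty (Fin n) := ⟨⟨0, hn⟩⟩
    obtain ⟨v, hv⟩ := ciInf_mem fun v => ((G \ H).neighborSet v).ncard
    have h1 : minDeg G ≤ (G.neighborSet v).ncard := ciInf_le (OrderBot.bddBelow _) v
    have h2 : (G.neighborSet v).ncard ≤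
        ((G \ H).neighborSet v).ncard + (H.neighborSet v).ncard := by
      refine (Set.ncard_le_ncard (fun w hw => ?_) (Set.toFinite _)).trans (Set.ncard_union_le _ _)
      by_cases h : H.Adj v w
      · exact Or.inr h
      · exact Or.inl ⟨hw, h⟩
    have h3 := hdeg v
    have h4 : minDeg G ≤ 2 * minDeg (G \ H) := by
      have : minDeg (G \ H) = ((G \ H).neighborSet v).ncard := hv.symm
      omega
    have h5 : (minDeg G : ℝ) ≤ 2 * minDeg (G \ H) := by exact_mod_cast h4
    have h6 : (0 : ℝ) ≤ minDeg G := Nat.cast_nonneg _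
    nlinarith
  · intro U W hUW hU hW
    have := hH U.toFinite.toFinset W.toFinite.toFinset
      (by rw [← Finset.disjoint_coe]; simpa using hUW)
      (by rw [← Set.ncard_coe_finset]; simpa using hU)
      (by rw [← Set.ncard_coe_finset]; simpa using hW)
    simpa using this
end

section
/- There exists a positive integer n0 such that for all n ≥ n0 the following holds. Let t be a positive integer with t ≤ (ln n)^{0.9}, let p satisfy 0.9·ln(n)/n ≤ p ≤ 1, and let G ~ G(n,p). Let D_t(G) denote the set of vertices of G having degree less than t. Then Pr[|D_t(G)| > n^{0.3}] ≤ exp(−n^{0.3}). -/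
open SimpleGraph Real

/-- The probability that the binomial random graph `G(n,p)` (on vertex set `Fin n`,
each of the `n.choose 2` possible edges present independently with probability `p`)
satisfies the property `P`. -/
noncomputable def probGnp (n : ℕ) (p : ℝ) (P : Set (SimpleGraph (Fin n))) : ℝ :=
  ∑ G : SimpleGraph (Fin n),
    P.indicator (fun G => p ^ G.edgeSet.ncard * (1 - p) ^ (n.choose 2 - G.edgeSet.ncard)) G

open Classical in
/-- Summing over graphs on `Fin n` amounts to summing over sets of non-loop pairs. -/
theorem sum_simpleGraph_eq_sum_powerset {n : ℕ} (f : Finset (Sym2 (Fin n)) → ℝ) :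
    ∑ G : SimpleGraph (Fin n), f G.edgeSet.toFinset =
      ∑ A ∈ (⊤ : SimpleGraph (Fin n)).edgeFinset.powerset, f A := by
  refine Finset.sum_bij' (fun G _ => G.edgeSet.toFinset)
    (fun A _ => SimpleGraph.fromEdgeSet (A : Set (Sym2 (Fin n)))) ?_ ?_ ?_ ?_ ?_
  · intro G _
    rw [Finset.mem_powerset]
    intro e he
    rw [Set.mem_toFinset] at he
    rw [mem_edgeFinset]
    exact edgeSet_mono le_top he
  · intro A _
    exact Finset.mem_univ _
  · intro G _
    simp
  · intro A hA
    rw [Finset.mem_powerset] at hA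
    ext e
    simp only [Set.mem_toFinset, edgeSet_fromEdgeSet, Set.mem_sdiff, Finset.mem_coe]
    refine ⟨fun h => h.1, fun h => ⟨h, ?_⟩⟩
    have := hA h
    rw [mem_edgeFinset] at this
    exact not_isDiag_of_mem_edgeSet _ this
  · intro G _
    rfl

/-- The probability generating function of the number of edges of `G(n,p)` inside a fixed set
`F` of non-loop pairs. -/
theorem sum_weight_mul_pow_card_inter {n : ℕ} (p x : ℝ) (F : Finset (Sym2 (Fin n)))
    (hF : F ⊆ (⊤ : SimpleGraph (Fin n)).edgeFinset) :
    ∑ G : SimpleGraph (Fin n), p ^ G.edgeSet.ncard * (1 - p) ^ (n.choose 2 - G.edgeSet.ncard) *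
      x ^ (G.edgeSet ∩ (F : Set (Sym2 (Fin n)))).ncard = (1 - p + p * x) ^ F.card := by
  classical
  set E := (⊤ : SimpleGraph (Fin n)).edgeFinset with hE
  have hcard : E.card = n.choose 2 := by
    rw [hE, card_edgeFinset_top_eq_card_choose_two, Fintype.card_fin]
  have h1 := sum_simpleGraph_eq_sum_powerset (n := n)
    (fun A => p ^ A.card * (1 - p) ^ (n.choose 2 - A.card) * x ^ (A ∩ F).card)
  calc _ = ∑ A ∈ E.powerset,
        p ^ A.card * (1 - p) ^ (n.choose 2 - A.card) * x ^ (A ∩ F).card := by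
        rw [← h1]
        refine Finset.sum_congr rfl fun G _ => ?_
        simp only [Set.ncard_eq_toFinset_card', Set.toFinset_inter, Finset.toFinset_coe]
    _ = ∑ A ∈ E.powerset, (∏ e ∈ A, p * (if e ∈ F then x else 1)) * ∏ _e ∈ E \ A, (1 - p) := by
        refine Finset.sum_congr rfl fun A hA => ?_
        rw [Finset.mem_powerset] at hA
        rw [Finset.prod_mul_distrib, Finset.prod_const, Finset.prod_const,
          Finset.card_sdiff_of_subset hA, hcard, Finset.prod_ite_mem, Finset.prod_const]
        ring
    _ = ∏ e ∈ E, (p * (if e ∈ F then x else 1) + (1 - p)) := by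
        rw [Finset.prod_add]
    _ = ∏ e ∈ E, (if e ∈ F then (1 - p + p * x) else 1) := by
        refine Finset.prod_congr rfl fun e _ => ?_
        split_ifs <;> ring
    _ = _ := by
        rw [Finset.prod_ite_mem, Finset.prod_const, Finset.inter_eq_right.mpr hF]

/-- The pairs with one endpoint in `S` and the other one outside. -/
def cutPairs {n : ℕ} (S : Finset (Fin n)) : Finset (Sym2 (Fin n)) :=
  (S ×ˢ Sᶜ).image fun q => s(q.1, q.2)

theorem cutPairs_subset {n : ℕ} (S : Finset (Fin n)) :
    cutPairs S ⊆ (⊤ : SimpleGraph (Fin n)).edgeFinset := by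
  intro e he
  obtain ⟨⟨a, b⟩, hab, rfl⟩ := Finset.mem_image.mp he
  rw [Finset.mem_product, Finset.mem_compl] at hab
  rw [mem_edgeFinset, mem_edgeSet, top_adj]
  rintro h
  exact hab.2 (h ▸ hab.1)

theorem card_cutPairs {n : ℕ} (S : Finset (Fin n)) :
    (cutPairs S).card = S.card * (n - S.card) := by
  rw [cutPairs, Finset.card_image_of_injOn, Finset.card_product, Finset.card_compl,
    Fintype.card_fin]
  rintro ⟨a, b⟩ hab ⟨c, d⟩ hcd h
  simp only [Finset.coe_product, Finset.coe_compl, Set.mem_prod, Finset.mem_coe,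
    Set.mem_compl_iff] at hab hcd
  rcases Sym2.eq_iff.mp h with ⟨rfl, rfl⟩ | ⟨rfl, rfl⟩
  · rfl
  · exact absurd hab.1 hcd.2

/-- If all vertices of `S` have degree less than `t`, few edges leave `S`. -/
theorem ncard_edgeSet_inter_cutPairs_le {n t : ℕ} (G : SimpleGraph (Fin n)) (S : Finset (Fin n))
    (h : ∀ v ∈ S, (G.neighborSet v).ncard < t) :
    (G.edgeSet ∩ (cutPairs S : Set (Sym2 (Fin n)))).ncard ≤ S.card * t := by
  classical
  have hsub : G.edgeSet ∩ (cutPairs S : Set (Sym2 (Fin n))) ⊆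
      (S.biUnion fun v => (G.neighborFinset v).image fun w => s(v, w) : Finset _) := by
    rintro e ⟨heG, heS⟩
    obtain ⟨⟨a, b⟩, hab, rfl⟩ := Finset.mem_image.mp (Finset.mem_coe.mp heS)
    rw [Finset.mem_product] at hab
    rw [Finset.mem_coe, Finset.mem_biUnion]
    exact ⟨a, hab.1, Finset.mem_image.mpr ⟨b, (mem_neighborFinset _ _ _).mpr heG, rfl⟩⟩
  refine (Set.ncard_le_ncard hsub (Finset.finite_toSet _)).trans ?_
  rw [Set.ncard_coe_finset]
  refine Finset.card_biUnion_le_card_mul _ _ _ fun v hv => Finset.card_image_le.trans ?_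
  have := (h v hv).le
  rwa [Set.ncard_eq_toFinset_card'] at this

/-- First-moment bound, combined with an exponential-moment bound, on the probability of having
at least `m` vertices of degree less than `t`. -/
theorem probGnp_le_choose_mul {n : ℕ} (m t : ℕ) {p x : ℝ} (hp0 : 0 ≤ p) (hp1 : p ≤ 1)
    (hx0 : 0 < x) (hx1 : x ≤ 1) :
    probGnp n p {G | m ≤ ({v : Fin n | (G.neighborSet v).ncard < t}).ncard} ≤
      n.choose m * ((x ^ (m * t))⁻¹ * (1 - p + p * x) ^ (m * (n - m))) := by
  classical
  let w : SimpleGraph (Fin n) → ℝ := fun G =>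
    p ^ G.edgeSet.ncard * (1 - p) ^ (n.choose 2 - G.edgeSet.ncard)
  have hw : ∀ G, 0 ≤ w G := fun G =>
    mul_nonneg (pow_nonneg hp0 _) (pow_nonneg (sub_nonneg.mpr hp1) _)
  let g : Finset (Fin n) → SimpleGraph (Fin n) → ℝ := fun S G =>
    (x ^ (m * t))⁻¹ * (w G * x ^ (G.edgeSet ∩ (cutPairs S : Set (Sym2 (Fin n)))).ncard)
  have hg : ∀ S G, 0 ≤ g S G := fun S G => by
    have := hw G
    positivity
  calc _ ≤ ∑ G : SimpleGraph (Fin n), ∑ S ∈ (Finset.univ : Finset (Fin n)).powersetCard m,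
        g S G := by
        refine Finset.sum_le_sum fun G _ => ?_
        refine Set.indicator_apply_le' (fun hG => ?_)
          fun _ => Finset.sum_nonneg fun S _ => hg S G
        rw [Set.mem_ofPred_eq, Set.ncard_eq_toFinset_card'] at hG
        obtain ⟨S, hS, hSm⟩ := Finset.exists_subset_card_eq hG
        refine le_trans ?_ (Finset.single_le_sum (fun S _ => hg S G)
          (Finset.mem_powersetCard.mpr ⟨Finset.subset_univ S, hSm⟩))
        have hle := ncard_edgeSet_inter_cutPairs_le (t := t) G S fun v hv => by
          simpa using hS hv
        rw [hSm] at hle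
        have hpow := pow_le_pow_of_le_one hx0.le hx1 hle
        change w G ≤ (x ^ (m * t))⁻¹ * (w G * _)
        rw [inv_mul_eq_div, le_div_iff₀ (by positivity)]
        exact mul_le_mul_of_nonneg_left hpow (hw G)
    _ = ∑ S ∈ (Finset.univ : Finset (Fin n)).powersetCard m,
        (x ^ (m * t))⁻¹ * (1 - p + p * x) ^ (m * (n - m)) := by
        rw [Finset.sum_comm]
        refine Finset.sum_congr rfl fun S hS => ?_
        rw [← Finset.mul_sum, sum_weight_mul_pow_card_inter p x _ (cutPairs_subset S),
          card_cutPairs, (Finset.mem_powersetCard.mp hS).2]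
    _ = _ := by
        rw [Finset.sum_const, Finset.card_powersetCard, Finset.card_univ, Fintype.card_fin,
          nsmul_eq_mul]

theorem choose_le_exp_one_mul_div_pow (n : ℕ) {m : ℕ} (hm : 0 < m) :
    (n.choose m : ℝ) ≤ (Real.exp 1 * (n / m)) ^ m := by
  have hm' : (0 : ℝ) < m := Nat.cast_pos.mpr hm
  have h1 : (m : ℝ) ^ m / m.factorial ≤ Real.exp m :=
    Real.pow_div_factorial_le_exp _ hm'.le _
  have hf : (0 : ℝ) < m.factorial := Nat.cast_pos.mpr m.factorial_pos
  calc (n.choose m : ℝ) ≤ n ^ m / m.factorial := Nat.choose_le_pow_div m n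
    _ = (m : ℝ) ^ m / m.factorial * (n / m) ^ m := by
        rw [div_pow]
        field_simp
    _ ≤ Real.exp m * (n / m) ^ m := by gcongr
    _ = _ := by rw [mul_pow, ← Real.exp_nat_mul, mul_one]

theorem eventually_rpow_le_mul {a c : ℝ} (ha : a < 1) (hc : 0 < c) :
    ∀ᶠ x : ℝ in Filter.atTop, x ^ a ≤ c * x := by
  filter_upwards [(tendsto_rpow_neg_atTop (sub_pos.mpr ha)).eventually_le_const hc,
    Filter.eventually_gt_atTop 0] with x h hx
  calc x ^ a = x ^ (-(1 - a)) * x := by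
        rw [← Real.rpow_add_one hx.ne']
        ring_nf
    _ ≤ c * x := by gcongr

theorem eventually_two_add_three_mul_log_rpow_le :
    ∀ᶠ n : ℕ in Filter.atTop,
      2 + 3 * Real.log n ^ (0.9 : ℝ) ≤ 0.1 * Real.log n := by
  have hlog : Filter.Tendsto (fun n : ℕ => Real.log n) Filter.atTop Filter.atTop :=
    Real.tendsto_log_atTop.comp tendsto_natCast_atTop_atTop
  filter_upwards [hlog.eventually (eventually_rpow_le_mul (a := 0.9) (c := 0.01)
    (by norm_num) (by norm_num)), hlog.eventually_ge_atTop 100] with n h1 h2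
  linarith

theorem eventually_rpow_add_one_le :
    ∀ᶠ n : ℕ in Filter.atTop, (n : ℝ) ^ (0.3 : ℝ) + 1 ≤ 0.01 * n := by
  have hcast := tendsto_natCast_atTop_atTop (R := ℝ)
  filter_upwards [hcast.eventually (eventually_rpow_le_mul (a := 0.3) (c := 0.005)
    (by norm_num) (by norm_num)), hcast.eventually_ge_atTop 200] with n h1 h2
  linarith

/-- For all large enough `n`, every positive integer `t ≤ (ln n)^{0.9}`
and every `p` with `0.9·ln n / n ≤ p ≤ 1`: for `G ~ G(n,p)`, the probability that more
than `n^{0.3}` vertices have degree less than `t` is at most `exp(-n^{0.3})`. -/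
theorem stmt10 :
    ∃ n0 : ℕ, 0 < n0 ∧ ∀ n : ℕ, n0 ≤ n →
      ∀ t : ℕ, 0 < t → (t : ℝ) ≤ Real.log n ^ (0.9 : ℝ) →
      ∀ p : ℝ, 0.9 * Real.log n / n ≤ p → p ≤ 1 →
        probGnp n p
            {G | (n : ℝ) ^ (0.3 : ℝ) <
              (({v : Fin n | (G.neighborSet v).ncard < t}).ncard : ℝ)} ≤
          Real.exp (-(n : ℝ) ^ (0.3 : ℝ)) := by
  obtain ⟨n0, hn0⟩ := Filter.eventually_atTop.mp
    (eventually_two_add_three_mul_log_rpow_le.and eventually_rpow_add_one_le)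
  refine ⟨n0 + 1, n0.succ_pos, fun n hn t _ ht p hp hp1 => ?_⟩
  obtain ⟨hlog, hpow⟩ := hn0 n (by omega)
  have hn1 : 1 ≤ n := by omega
  have hnpos : (0 : ℝ) < n := Nat.cast_pos.mpr hn1
  have hL : 0 ≤ Real.log n := Real.log_natCast_nonneg n
  have hp0 : 0 ≤ p := le_trans (by positivity) hp
  set m := ⌊(n : ℝ) ^ (0.3 : ℝ)⌋₊ + 1 with hm
  have hnm : (n : ℝ) ^ (0.3 : ℝ) < m := by
    rw [hm, Nat.cast_succ]
    exact Nat.lt_floor_add_one _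
  have hmn : (m : ℝ) ≤ 0.01 * n := by
    rw [hm, Nat.cast_succ]
    linarith [Nat.floor_le (show 0 ≤ (n : ℝ) ^ (0.3 : ℝ) by positivity)]
  have hm0 : 0 < m := Nat.succ_pos _
  have hmn' : m ≤ n := by
    have : (m : ℝ) ≤ n := by linarith
    exact_mod_cast this
  have hset : {G : SimpleGraph (Fin n) | (n : ℝ) ^ (0.3 : ℝ) <
      (({v : Fin n | (G.neighborSet v).ncard < t}).ncard : ℝ)} =
      {G | m ≤ ({v : Fin n | (G.neighborSet v).ncard < t}).ncard} := by
    ext G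
    rw [Set.mem_ofPred_eq, Set.mem_ofPred_eq, hm, Nat.succ_le_iff,
      Nat.floor_lt (by positivity)]
  rw [hset]
  have hratio : (n : ℝ) / m ≤ Real.exp (0.7 * Real.log n) := by
    rw [div_le_iff₀ (Nat.cast_pos.mpr hm0)]
    calc (n : ℝ) = Real.exp (0.7 * Real.log n) * (n : ℝ) ^ (0.3 : ℝ) := by
          rw [Real.rpow_def_of_pos hnpos, ← Real.exp_add]
          ring_nf
          rw [Real.exp_log hnpos]
      _ ≤ _ := by gcongr
  have hten : (((0.1 : ℝ)) ^ t)⁻¹ ≤ Real.exp (3 * t) := by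
    rw [← inv_pow, mul_comm, Real.exp_nat_mul]
    refine pow_le_pow_left₀ (by norm_num) ?_ _
    have h := pow_le_pow_left₀ (by norm_num) Real.exp_one_gt_d9.le 3
    rw [← Real.exp_nat_mul] at h
    norm_num at h ⊢
    linarith
  have hpn : 0.9 * 0.99 * Real.log n ≤ p * ((n - m : ℕ) : ℝ) := by
    rw [Nat.cast_sub hmn']
    rw [div_le_iff₀ hnpos] at hp
    nlinarith
  have hedge : (1 - p + p * 0.1) ^ (n - m) ≤ Real.exp (-(0.8 * Real.log n)) := by
    have hb : 1 - p + p * 0.1 ≤ Real.exp (-(0.9 * p)) := by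
      linarith [Real.add_one_le_exp (-(0.9 * p))]
    refine (pow_le_pow_left₀ (by linarith) hb _).trans ?_
    rw [← Real.exp_nat_mul, Real.exp_le_exp]
    linarith
  calc _ ≤ n.choose m *
        (((0.1 : ℝ) ^ (m * t))⁻¹ * (1 - p + p * 0.1) ^ (m * (n - m))) :=
        probGnp_le_choose_mul m t hp0 hp1 (by norm_num) (by norm_num)
    _ ≤ (Real.exp 1 * (n / m)) ^ m *
        (((0.1 : ℝ) ^ (m * t))⁻¹ * (1 - p + p * 0.1) ^ (m * (n - m))) := by
        have : 0 ≤ 1 - p + p * 0.1 := by linarith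
        gcongr
        exact choose_le_exp_one_mul_div_pow n hm0
    _ = (Real.exp 1 * (n / m) * (((0.1 : ℝ) ^ t)⁻¹ * (1 - p + p * 0.1) ^ (n - m))) ^ m := by
        rw [mul_pow _ ((_)⁻¹ * _) m, mul_pow (_)⁻¹ _ m, inv_pow, ← pow_mul, ← pow_mul,
          mul_comm t, mul_comm (n - m)]
    _ ≤ (Real.exp (-1)) ^ m := by
        have h0 : 0 ≤ 1 - p + p * 0.1 := by linarith
        refine pow_le_pow_left₀ (by positivity) ?_ _
        calc _ ≤ Real.exp 1 * Real.exp (0.7 * Real.log n) *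
              (Real.exp (3 * t) * Real.exp (-(0.8 * Real.log n))) := by gcongr
          _ ≤ _ := by
            rw [← Real.exp_add, ← Real.exp_add, ← Real.exp_add, Real.exp_le_exp]
            linarith
    _ ≤ _ := by
        rw [← Real.exp_nat_mul, Real.exp_le_exp]
        linarith
end

section
/- Let p = p(n) be any sequence with 0 ≤ p(n) ≤ 2·ln(n)/n, and let G ~ G(n, p(n)). Then the probability that there exists a subset U of vertices with 1 ≤ |U| ≤ n/(ln n)^{0.3} and e_G(U) ≥ |U|·(ln n)^{0.8} tends to 0 as n tends to infinity. -/
open SimpleGraph Real Filter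

/-- A sum over all graphs on a finite vertex set is a sum over all sets of non-loops. -/
lemma sum_simpleGraph_eq_sum_powerset_s11 {V M : Type*} [Fintype V] [DecidableEq V]
    [AddCommMonoid M] (f : Set (Sym2 V) → M) :
    ∑ G : SimpleGraph V, f G.edgeSet =
      ∑ s ∈ (⊤ : SimpleGraph V).edgeFinset.powerset, f (s : Set (Sym2 V)) := by
  classical
  refine Finset.sum_bij' (fun G _ => G.edgeFinset) (fun s _ => fromEdgeSet (s : Set (Sym2 V)))
    ?_ ?_ ?_ ?_ ?_
  · intro G _
    simp only [Finset.mem_powerset]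
    exact edgeFinset_mono le_top
  · simp
  · intro G _
    simp
  · intro s hs
    ext e
    have h : e ∈ s → ¬ e.IsDiag := fun he => by
      simpa using Finset.mem_powerset.1 hs he
    simpa using h
  · intro G _
    simp

/-- The exponential moment of the number of edges of `G(n,p)` inside `U`. -/
lemma sum_weight_mul_pow_edgesIn_le {n : ℕ} {p a : ℝ} (hp0 : 0 ≤ p) (hp1 : p ≤ 1) (ha : 0 ≤ a)
    (U : Finset (Fin n)) :
    ∑ G : SimpleGraph (Fin n), p ^ G.edgeSet.ncard * (1 - p) ^ (n.choose 2 - G.edgeSet.ncard) *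
      a ^ edgesIn G (U : Set (Fin n)) ≤ Real.exp (p * a * (U.card : ℝ) ^ 2) := by
  classical
  set T := (⊤ : SimpleGraph (Fin n)).edgeFinset with hT
  have hTcard : T.card = n.choose 2 := by
    rw [hT, card_edgeFinset_top_eq_card_choose_two, Fintype.card_fin]
  have hprod : ∑ G : SimpleGraph (Fin n),
      p ^ G.edgeSet.ncard * (1 - p) ^ (n.choose 2 - G.edgeSet.ncard) *
      a ^ edgesIn G (U : Set (Fin n)) =
      ∏ e ∈ T, (p * (if e ∈ U.sym2 then a else 1) + (1 - p)) := by
    rw [Finset.prod_add]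
    have := sum_simpleGraph_eq_sum_powerset_s11 (V := Fin n) (fun E => p ^ E.ncard *
      (1 - p) ^ (n.choose 2 - E.ncard) * a ^ {e ∈ E | ∀ v ∈ e, v ∈ (U : Set (Fin n))}.ncard)
    refine this.trans (Finset.sum_congr rfl fun s hs => ?_)
    have hset : {e ∈ (s : Set (Sym2 (Fin n))) | ∀ v ∈ e, v ∈ (U : Set (Fin n))} =
        ((s.filter (· ∈ U.sym2) : Finset _) : Set (Sym2 (Fin n))) := by
      ext e
      simp [Finset.mem_sym2_iff]
    rw [hset, Set.ncard_coe_finset, Set.ncard_coe_finset, Finset.prod_mul_distrib,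
      Finset.prod_const, Finset.prod_const, Finset.card_sdiff_of_subset (Finset.mem_powerset.1 hs),
      hTcard, ← Finset.prod_filter, Finset.prod_const]
    ring
  rw [hprod]
  calc ∏ e ∈ T, (p * (if e ∈ U.sym2 then a else 1) + (1 - p))
      ≤ ∏ e ∈ T, (if e ∈ U.sym2 then Real.exp (p * a) else 1) := by
        refine Finset.prod_le_prod (fun e _ => ?_) fun e _ => ?_
        · split_ifs <;> nlinarith [mul_nonneg hp0 ha]
        · split_ifs
          · linarith [Real.add_one_le_exp (p * a)]
          · linarith
    _ = Real.exp (p * a) ^ (T.filter (· ∈ U.sym2)).card := by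
        rw [← Finset.prod_filter, Finset.prod_const]
    _ ≤ Real.exp (p * a) ^ (U.card ^ 2) := by
        refine pow_le_pow_right₀ (Real.one_le_exp (mul_nonneg hp0 ha)) ?_
        calc (T.filter (· ∈ U.sym2)).card ≤ U.sym2.card :=
              Finset.card_le_card fun e he => (Finset.mem_filter.1 he).2
          _ = (U.card + 1).choose 2 := Finset.card_sym2 U
          _ ≤ U.card ^ 2 := by
              rw [Nat.choose_two_right]
              refine Nat.div_le_of_le_mul ?_
              simp only [Nat.add_sub_cancel]
              nlinarith [Nat.zero_le U.card, Nat.le_self_pow two_ne_zero U.card]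
    _ = Real.exp (p * a * (U.card : ℝ) ^ 2) := by
        rw [← Real.exp_nat_mul]
        push_cast
        ring_nf

lemma probGnp_nonneg {n : ℕ} {p : ℝ} (hp0 : 0 ≤ p) (hp1 : p ≤ 1)
    (P : Set (SimpleGraph (Fin n))) : 0 ≤ probGnp n p P :=
  Finset.sum_nonneg fun _ _ => Set.indicator_nonneg (fun _ _ =>
    mul_nonneg (pow_nonneg hp0 _) (pow_nonneg (by linarith) _)) _

/-- Union bound over `S` combined with an exponential Markov inequality for each set. -/
lemma probGnp_exists_le_edgesIn_le {n : ℕ} {p : ℝ} (hp0 : 0 ≤ p) (hp1 : p ≤ 1)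
    (S : Finset (Finset (Fin n))) (a t : Finset (Fin n) → ℝ) (ha : ∀ U ∈ S, 1 ≤ a U) :
    probGnp n p {G | ∃ U ∈ S, t U ≤ (edgesIn G (U : Set (Fin n)) : ℝ)} ≤
      ∑ U ∈ S, a U ^ (-t U) * Real.exp (p * a U * (U.card : ℝ) ^ 2) := by
  classical
  have hw : ∀ G : SimpleGraph (Fin n),
      0 ≤ p ^ G.edgeSet.ncard * (1 - p) ^ (n.choose 2 - G.edgeSet.ncard) := fun G =>
    mul_nonneg (pow_nonneg hp0 _) (pow_nonneg (by linarith) _)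
  calc probGnp n p {G | ∃ U ∈ S, t U ≤ (edgesIn G (U : Set (Fin n)) : ℝ)}
      ≤ ∑ G : SimpleGraph (Fin n), ∑ U ∈ S, a U ^ (-t U) *
          (p ^ G.edgeSet.ncard * (1 - p) ^ (n.choose 2 - G.edgeSet.ncard) *
            a U ^ edgesIn G (U : Set (Fin n))) := by
        refine Finset.sum_le_sum fun G _ => ?_
        have hterm : ∀ U ∈ S, 0 ≤ a U ^ (-t U) *
            (p ^ G.edgeSet.ncard * (1 - p) ^ (n.choose 2 - G.edgeSet.ncard) *
              a U ^ edgesIn G (U : Set (Fin n))) := fun U hU => by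
          have := ha U hU
          exact mul_nonneg (by positivity) (mul_nonneg (hw G) (by positivity))
        refine Set.indicator_apply_le' ?_ fun _ => Finset.sum_nonneg hterm
        rintro ⟨U, hU, ht⟩
        refine le_trans ?_ (Finset.single_le_sum hterm hU)
        have h1 : 1 ≤ a U ^ (-t U) * a U ^ edgesIn G (U : Set (Fin n)) := by
          rw [← Real.rpow_natCast, ← Real.rpow_add (by linarith [ha U hU])]
          exact Real.one_le_rpow (ha U hU) (by linarith)
        calc _ ≤ (p ^ G.edgeSet.ncard * (1 - p) ^ (n.choose 2 - G.edgeSet.ncard)) *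
              (a U ^ (-t U) * a U ^ edgesIn G (U : Set (Fin n))) :=
              le_mul_of_one_le_right (hw G) h1
          _ = _ := by ring
    _ = ∑ U ∈ S, a U ^ (-t U) * ∑ G : SimpleGraph (Fin n),
          (p ^ G.edgeSet.ncard * (1 - p) ^ (n.choose 2 - G.edgeSet.ncard) *
            a U ^ edgesIn G (U : Set (Fin n))) := by
        rw [Finset.sum_comm]
        exact Finset.sum_congr rfl fun U _ => (Finset.mul_sum _ _ _).symm
    _ ≤ _ := by
        refine Finset.sum_le_sum fun U hU => ?_
        have := ha U hU
        exact mul_le_mul_of_nonneg_left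
          (sum_weight_mul_pow_edgesIn_le hp0 hp1 (by linarith) U) (by positivity)

lemma choose_le_exp_mul {n k : ℕ} (hk : 1 ≤ k) (hn : 1 ≤ n) :
    (n.choose k : ℝ) ≤ Real.exp (k * (1 + Real.log (n / k))) := by
  have hk' : (0 : ℝ) < k := by exact_mod_cast hk
  have hn' : (0 : ℝ) < n := by exact_mod_cast hn
  have h1 : (k : ℝ) ^ k / k.factorial ≤ Real.exp k := Real.pow_div_factorial_le_exp _ hk'.le k
  calc (n.choose k : ℝ) ≤ (n : ℝ) ^ k / k.factorial := Nat.choose_le_pow_div k n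
    _ = (k : ℝ) ^ k / k.factorial * (n / k : ℝ) ^ k := by
        rw [div_pow]; field_simp
    _ ≤ Real.exp k * (n / k : ℝ) ^ k := by gcongr
    _ = _ := by
        rw [mul_add, Real.exp_add, mul_one, Real.exp_nat_mul, Real.exp_log (by positivity)]

/-- The contribution of the sets of size `k` to the union bound, with the exponential parameter
`n / (k (ln n)^{0.2})`. -/
lemma choose_mul_moment_bound_le {n k : ℕ} {p L : ℝ} (hk : 1 ≤ k) (hn : 1 ≤ n)
    (hL : Real.exp 40 ≤ L) (hp2 : p ≤ 2 * L / n) (hkn : (k : ℝ) ≤ n / L ^ (0.3 : ℝ)) :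
    1 ≤ Real.exp (Real.log (n / k) - 0.2 * Real.log L) ∧
    (n.choose k : ℝ) * (Real.exp (Real.log (n / k) - 0.2 * Real.log L) ^ (-(k * L ^ (0.8 : ℝ))) *
      Real.exp (p * Real.exp (Real.log (n / k) - 0.2 * Real.log L) * (k : ℝ) ^ 2)) ≤
      (L ^ (-0.3 : ℝ)) ^ k := by
  have hk' : (0 : ℝ) < k := by exact_mod_cast hk
  have hn' : (0 : ℝ) < n := by exact_mod_cast hn
  have hL0 : 0 < L := (Real.exp_pos _).trans_le hL
  set y := Real.log L with hy
  set x := Real.log (n / k) with hx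
  have hy40 : 40 ≤ y := (Real.le_log_iff_exp_le hL0).2 hL
  have hxy : 0.3 * y ≤ x := by
    rw [hy, ← Real.log_rpow hL0]
    refine Real.log_le_log (by positivity) ?_
    rw [le_div_iff₀ (by positivity)] at hkn ⊢
    linarith
  have hex : Real.exp x = n / k := Real.exp_log (by positivity)
  have heL : L = Real.exp y := (Real.exp_log hL0).symm
  refine ⟨Real.one_le_exp (by linarith), ?_⟩
  have hA : L ^ (0.8 : ℝ) = Real.exp (0.8 * y) := by
    rw [Real.rpow_def_of_pos hL0, mul_comm]
  set A := L ^ (0.8 : ℝ) with hAdef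
  have hA18 : 18 ≤ A := by
    rw [hA]; linarith [Real.add_one_le_exp (0.8 * y)]
  have hmean : p * Real.exp (x - 0.2 * y) * (k : ℝ) ^ 2 ≤ 2 * k * A := by
    calc p * Real.exp (x - 0.2 * y) * (k : ℝ) ^ 2
        ≤ 2 * L / n * Real.exp (x - 0.2 * y) * (k : ℝ) ^ 2 := by gcongr
      _ = 2 * k * (Real.exp y * Real.exp (-(0.2 * y))) := by
          rw [sub_eq_add_neg, Real.exp_add, hex, ← heL]
          field_simp
      _ = 2 * k * A := by
          rw [← Real.exp_add, hA]; ring_nf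
  have heps : (L ^ (-0.3 : ℝ)) ^ k = Real.exp (k * (-(0.3 * y))) := by
    rw [Real.rpow_def_of_pos hL0, Real.exp_nat_mul, ← hy]; ring_nf
  rw [heps, ← Real.exp_mul, ← Real.exp_add]
  refine (mul_le_mul_of_nonneg_right (choose_le_exp_mul hk hn) (Real.exp_pos _).le).trans ?_
  rw [← Real.exp_add, ← hx, Real.exp_le_exp]
  have key : 1 + x + (2 * A - (x - 0.2 * y) * A) ≤ -(0.3 * y) := by
    nlinarith [mul_nonneg (show 0 ≤ A - 18 by linarith) (show 0 ≤ x - 12 by linarith),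
      mul_nonneg (show 0 ≤ A by linarith) (show 0 ≤ x - 0.3 * y by linarith)]
  nlinarith [mul_le_mul_of_nonneg_left key hk'.le]

/-- A quantitative form of the main theorem. -/
lemma probGnp_exists_dense_le {n : ℕ} {p : ℝ} (hn : 1 ≤ n) (hL : Real.exp 40 ≤ Real.log n)
    (hp0 : 0 ≤ p) (hp1 : p ≤ 1) (hp2 : p ≤ 2 * Real.log n / n) :
    probGnp n p {G | ∃ U : Set (Fin n), 1 ≤ U.ncard ∧
      (U.ncard : ℝ) ≤ (n : ℝ) / Real.log n ^ (0.3 : ℝ) ∧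
      (U.ncard : ℝ) * Real.log n ^ (0.8 : ℝ) ≤ (edgesIn G U : ℝ)} ≤
      Real.log n ^ (-0.3 : ℝ) * (1 - Real.log n ^ (-0.3 : ℝ))⁻¹ := by
  classical
  set L := Real.log n with hLdef
  have hL1 : 1 < L := (Real.one_lt_exp_iff.2 (by norm_num)).trans_le hL
  set ε := L ^ (-0.3 : ℝ) with hε
  have hε0 : 0 ≤ ε := by positivity
  have hε1 : ε < 1 := Real.rpow_lt_one_of_one_lt_of_neg hL1 (by norm_num)
  set Q : ℕ → Prop := fun k => 1 ≤ k ∧ (k : ℝ) ≤ (n : ℝ) / L ^ (0.3 : ℝ) with hQ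
  set S : Finset (Finset (Fin n)) := Finset.univ.filter fun U => Q U.card with hS
  set b : ℕ → ℝ := fun k => Real.exp (Real.log (n / k) - 0.2 * Real.log L) with hb
  set f : ℕ → ℝ := fun k => b k ^ (-(k * L ^ (0.8 : ℝ))) * Real.exp (p * b k * (k : ℝ) ^ 2)
    with hf
  have hset : {G : SimpleGraph (Fin n) | ∃ U : Set (Fin n), 1 ≤ U.ncard ∧
      (U.ncard : ℝ) ≤ (n : ℝ) / L ^ (0.3 : ℝ) ∧
      (U.ncard : ℝ) * L ^ (0.8 : ℝ) ≤ (edgesIn G U : ℝ)} =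
      {G | ∃ U ∈ S, (U.card : ℝ) * L ^ (0.8 : ℝ) ≤ (edgesIn G (U : Set (Fin n)) : ℝ)} := by
    ext G
    constructor
    · rintro ⟨U, h1, h2, h3⟩
      refine ⟨U.toFinset, ?_, ?_⟩
      · rw [Set.ncard_eq_toFinset_card'] at h1 h2
        exact Finset.mem_filter.2 ⟨Finset.mem_univ _, h1, h2⟩
      · rwa [Set.coe_toFinset, ← Set.ncard_eq_toFinset_card']
    · rintro ⟨U, hU, h3⟩
      obtain ⟨h1, h2⟩ := (Finset.mem_filter.1 hU).2
      refine ⟨U, ?_⟩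
      rw [Set.ncard_coe_finset]
      exact ⟨h1, h2, h3⟩
  rw [hset]
  calc _ ≤ ∑ U ∈ S, f U.card :=
        probGnp_exists_le_edgesIn_le hp0 hp1 S (fun U => b U.card)
          (fun U => (U.card : ℝ) * L ^ (0.8 : ℝ)) fun U hU =>
            (choose_mul_moment_bound_le (Finset.mem_filter.1 hU).2.1 hn hL hp2
              (Finset.mem_filter.1 hU).2.2).1
    _ = ∑ k ∈ Finset.range (n + 1), (n.choose k : ℝ) * (if Q k then f k else 0) := by
        have h := Finset.sum_powerset_apply_card (fun k => if Q k then f k else 0)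
          (x := (Finset.univ : Finset (Fin n)))
        rw [Finset.powerset_univ, Finset.card_univ, Fintype.card_fin] at h
        rw [hS, Finset.sum_filter, h]
        simp only [nsmul_eq_mul]
    _ ≤ ∑ k ∈ Finset.range (n + 1), (if 1 ≤ k then ε ^ k else 0) := by
        refine Finset.sum_le_sum fun k _ => ?_
        by_cases hk : Q k
        · rw [if_pos hk, if_pos hk.1]
          exact (choose_mul_moment_bound_le hk.1 hn hL hp2 hk.2).2
        · rw [if_neg hk, mul_zero]
          split_ifs <;> positivity
    _ = ε * ∑ k ∈ Finset.range n, ε ^ k := by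
        rw [Finset.sum_range_succ', Finset.mul_sum]
        simp [pow_succ']
    _ ≤ ε * (1 - ε)⁻¹ := by
        refine mul_le_mul_of_nonneg_left ?_ hε0
        rw [← tsum_geometric_of_lt_one hε0 hε1]
        exact (summable_geometric_of_lt_one hε0 hε1).sum_le_tsum _ fun _ _ => by positivity

/-- If `0 ≤ p(n) ≤ 2·ln n / n` for every `n`, then the probability that
`G ~ G(n, p(n))` contains a vertex set `U` with `1 ≤ |U| ≤ n/(ln n)^{0.3}` and
`e_G(U) ≥ |U|·(ln n)^{0.8}` tends to `0` as `n → ∞`. -/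
theorem stmt11 (p : ℕ → ℝ) (hp0 : ∀ n, 0 ≤ p n) (hp2 : ∀ n, p n ≤ 2 * Real.log n / n) :
    Tendsto (fun n : ℕ =>
        probGnp n (p n) {G | ∃ U : Set (Fin n), 1 ≤ U.ncard ∧
          (U.ncard : ℝ) ≤ (n : ℝ) / Real.log n ^ (0.3 : ℝ) ∧
          (U.ncard : ℝ) * Real.log n ^ (0.8 : ℝ) ≤ (edgesIn G U : ℝ)})
      atTop (nhds 0) := by
  have hlog : Tendsto (fun n : ℕ => Real.log n) atTop atTop :=
    Real.tendsto_log_atTop.comp tendsto_natCast_atTop_atTop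
  have hε : Tendsto (fun n : ℕ => Real.log n ^ (-0.3 : ℝ)) atTop (nhds 0) :=
    (tendsto_rpow_neg_atTop (by norm_num : (0 : ℝ) < 0.3)).comp hlog
  have hlim : Tendsto (fun n : ℕ => Real.log n ^ (-0.3 : ℝ) * (1 - Real.log n ^ (-0.3 : ℝ))⁻¹)
      atTop (nhds 0) := by
    have h := hε.mul ((hε.const_sub 1).inv₀ (by norm_num))
    simpa using h
  have hp1 : ∀ᶠ n : ℕ in atTop, p n ≤ 1 := by
    have h : Tendsto (fun n : ℕ => 2 * (Real.log n / n)) atTop (nhds (2 * 0)) :=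
      ((Real.isLittleO_log_id_atTop.tendsto_div_nhds_zero).comp
        tendsto_natCast_atTop_atTop).const_mul 2
    rw [mul_zero] at h
    filter_upwards [h.eventually_le_const zero_lt_one] with n hn
    exact (hp2 n).trans (by rwa [mul_div_assoc])
  refine tendsto_of_tendsto_of_tendsto_of_le_of_le' tendsto_const_nhds hlim ?_ ?_
  · filter_upwards [hp1] with n hn using probGnp_nonneg (hp0 n) hn _
  · filter_upwards [hp1, hlog.eventually_ge_atTop (Real.exp 40), eventually_ge_atTop 1]
      with n h1 hL hn using probGnp_exists_dense_le hn hL (hp0 n) h1 (hp2 n)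
end

section
/- Let p = p(n) be any sequence with ln(n)/n ≤ p(n) ≤ 1, let r = r(n) = ⌈n/(2·(ln n)^{0.4})⌉, and let G ~ G(n, p(n)). Then the probability that there exists a pair of disjoint vertex subsets U, W with |U| = |W| = r and e_G(U,W) < n·(ln n)^{0.1} tends to 0 as n tends to infinity. -/
open SimpleGraph Real Filter

open Finset in
/-- The generating function of the number of edges of `G(n,p)` that lie in a fixed set `S` of
potential edges. -/
theorem sum_gnp_weight_mul_pow (n : ℕ) (p z : ℝ) (S : Finset (Sym2 (Fin n)))
    (hS : ∀ e ∈ S, ¬ e.IsDiag) :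
    ∑ G : SimpleGraph (Fin n), p ^ G.edgeSet.ncard * (1 - p) ^ (n.choose 2 - G.edgeSet.ncard) *
      z ^ (G.edgeSet ∩ S).ncard = (1 - p + p * z) ^ #S := by
  classical
  set A : Finset (Sym2 (Fin n)) := (⊤ : SimpleGraph (Fin n)).edgeFinset with hA
  have mem_A (e : Sym2 (Fin n)) : e ∈ A ↔ ¬ e.IsDiag := by simp [hA]
  have card_A : #A = n.choose 2 := by
    rw [hA, SimpleGraph.card_edgeFinset_top_eq_card_choose_two, Fintype.card_fin]
  have hSA : S ⊆ A := fun e he => (mem_A e).2 (hS e he)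
  have expand := Finset.prod_add (fun e => p * if e ∈ S then z else 1) (fun _ => 1 - p) A
  have lhs : ∏ e ∈ A, ((p * if e ∈ S then z else 1) + (1 - p)) = (1 - p + p * z) ^ #S := by
    rw [← Finset.prod_subset hSA, ← Finset.prod_const]
    · refine Finset.prod_congr rfl fun e he => ?_
      rw [if_pos he]; ring
    · intro e _ he
      rw [if_neg he]; ring
  rw [← lhs, expand]
  refine Finset.sum_bij' (fun G _ => G.edgeFinset)
    (fun T _ => SimpleGraph.fromEdgeSet (T : Set (Sym2 (Fin n)))) ?_ ?_ ?_ ?_ ?_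
  · intro G _
    rw [Finset.mem_powerset]
    intro e he
    exact (mem_A e).2 (G.not_isDiag_of_mem_edgeFinset he)
  · intros; exact Finset.mem_univ _
  · intro G _
    simp
  · intro T hT
    rw [Finset.mem_powerset] at hT
    ext e
    simp only [SimpleGraph.mem_edgeFinset, SimpleGraph.edgeSet_fromEdgeSet]
    have := fun h => (mem_A e).1 (hT h)
    simp only [Set.mem_sdiff, Finset.mem_coe, Sym2.mem_diagSet]
    tauto
  · intro G _
    have hsub : G.edgeFinset ⊆ A := fun e he =>
      (mem_A e).2 (G.not_isDiag_of_mem_edgeFinset he)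
    have h1 : G.edgeSet.ncard = #G.edgeFinset := by
      rw [← SimpleGraph.coe_edgeFinset, Set.ncard_coe_finset]
    have h2 : (G.edgeSet ∩ S).ncard = #(G.edgeFinset ∩ S) := by
      rw [← SimpleGraph.coe_edgeFinset, ← Finset.coe_inter, Set.ncard_coe_finset]
    rw [Finset.prod_mul_distrib, Finset.prod_const, Finset.prod_const, h1, h2,
      Finset.prod_ite_mem, Finset.prod_const, Finset.card_sdiff_of_subset hsub, card_A]
    ring

open Finset in
/-- Between disjoint sets `U`, `W` there are `|U| |W|` potential edges. -/
theorem card_image_mk_product {V : Type*} [DecidableEq V] {U W : Finset V} (h : Disjoint U W) :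
    #((U ×ˢ W).image fun x => s(x.1, x.2)) = #U * #W := by
  rw [Finset.card_image_of_injOn, Finset.card_product]
  rintro ⟨a, b⟩ hab ⟨c, d⟩ hcd heq
  simp only [Finset.coe_product, Set.mem_prod, Finset.mem_coe] at hab hcd
  rcases Sym2.eq_iff.1 heq with ⟨h1, h2⟩ | ⟨h1, -⟩
  · exact Prod.ext h1 h2
  · exact absurd hcd.2 (Finset.disjoint_left.1 h ((show a = d from h1) ▸ hab.1))

open Finset in
/-- First-moment bound for the event that two disjoint sets of size `r` span fewer than `t`
edges. -/
theorem probGnp_exists_sparse_pair_le (n r : ℕ) (p t : ℝ) (hp0 : 0 ≤ p) (hp1 : p ≤ 1) :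
    probGnp n p {G | ∃ U W : Set (Fin n), Disjoint U W ∧ U.ncard = r ∧ W.ncard = r ∧
      (edgesBetween G U W : ℝ) < t} ≤ 4 ^ n * (2 : ℝ) ^ t * (1 - p / 2) ^ (r * r) := by
  classical
  set B : Finset (Finset (Fin n) × Finset (Fin n)) :=
    {x | Disjoint x.1 x.2 ∧ #x.1 = r ∧ #x.2 = r} with hB
  let w : SimpleGraph (Fin n) → ℝ := fun G =>
    p ^ G.edgeSet.ncard * (1 - p) ^ (n.choose 2 - G.edgeSet.ncard)
  let S : Finset (Fin n) × Finset (Fin n) → Finset (Sym2 (Fin n)) := fun x =>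
    (x.1 ×ˢ x.2).image fun y => s(y.1, y.2)
  have hw (G) : 0 ≤ w G := mul_nonneg (pow_nonneg hp0 _) (pow_nonneg (sub_nonneg.2 hp1) _)
  have hterm (G) (x) : 0 ≤ (2 : ℝ) ^ t * (w G * (1 / 2) ^ (G.edgeSet ∩ S x).ncard) :=
    mul_nonneg (by positivity) (mul_nonneg (hw G) (by positivity))
  calc
    _ ≤ ∑ G : SimpleGraph (Fin n), ∑ x ∈ B,
          (2 : ℝ) ^ t * (w G * (1 / 2) ^ (G.edgeSet ∩ S x).ncard) := by
      refine Finset.sum_le_sum fun G _ => Set.indicator_apply_le' ?_ fun _ =>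
        Finset.sum_nonneg fun x _ => hterm G x
      rintro ⟨U, W, hd, hU, hW, hlt⟩
      have hx : (U.toFinset, W.toFinset) ∈ B := by
        rw [hB, Finset.mem_filter]
        exact ⟨Finset.mem_univ _, Set.disjoint_toFinset.2 hd,
          by rw [← hU, Set.ncard_eq_toFinset_card'], by rw [← hW, Set.ncard_eq_toFinset_card']⟩
      refine le_trans ?_ (Finset.single_le_sum (fun x _ => hterm G x) hx)
      have he : G.edgeSet ∩ S (U.toFinset, W.toFinset) =
          {e ∈ G.edgeSet | ∃ u ∈ U, ∃ w ∈ W, e = s(u, w)} := by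
        ext e
        simp only [S, Set.mem_inter_iff, Finset.mem_coe, Finset.mem_image, Finset.mem_product,
          Set.mem_toFinset, Prod.exists, Set.mem_ofPred_eq]
        refine and_congr_right fun _ => ⟨?_, ?_⟩
        · rintro ⟨a, b, ⟨ha, hb⟩, rfl⟩
          exact ⟨a, ha, b, hb, rfl⟩
        · rintro ⟨a, ha, b, hb, rfl⟩
          exact ⟨a, b, ⟨ha, hb⟩, rfl⟩
      have hone : 1 ≤ (2 : ℝ) ^ t * (1 / 2) ^ (G.edgeSet ∩ S (U.toFinset, W.toFinset)).ncard := by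
        rw [he]
        change 1 ≤ (2 : ℝ) ^ t * (1 / 2) ^ edgesBetween G U W
        rw [one_div, inv_pow, ← Real.rpow_natCast, ← Real.rpow_neg two_pos.le,
          ← Real.rpow_add two_pos]
        exact Real.one_le_rpow one_le_two (by linarith)
      calc w G = w G * 1 := (mul_one _).symm
        _ ≤ w G * _ := mul_le_mul_of_nonneg_left hone (hw G)
        _ = _ := by ring
    _ = ∑ x ∈ B, (2 : ℝ) ^ t * (1 - p / 2) ^ (r * r) := by
      rw [Finset.sum_comm]
      refine Finset.sum_congr rfl fun x hx => ?_
      rw [hB, Finset.mem_filter] at hx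
      obtain ⟨-, hd, h1, h2⟩ := hx
      rw [← Finset.mul_sum, sum_gnp_weight_mul_pow, card_image_mk_product hd, h1, h2]
      · congr 2; ring
      · intro e he
        obtain ⟨⟨a, b⟩, hab, rfl⟩ := Finset.mem_image.1 he
        rw [Finset.mem_product] at hab
        rw [Sym2.mk_isDiag_iff]
        exact fun h => Finset.disjoint_left.1 hd hab.1 (h ▸ hab.2)
    _ ≤ _ := by
      rw [Finset.sum_const, nsmul_eq_mul, ← mul_assoc]
      have hc : (#B : ℝ) ≤ 4 ^ n := by
        have h : #B ≤ 4 ^ n := by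
          refine (Finset.card_le_univ B).trans (le_of_eq ?_)
          rw [Fintype.card_prod, Fintype.card_finset, Fintype.card_fin, ← mul_pow]
          norm_num
        exact_mod_cast h
      have : (0 : ℝ) ≤ 1 - p / 2 := by linarith
      gcongr

/-- The first-moment bound with the parameters of the theorem is at most `exp (-n)` once
`ln n` is large. -/
theorem sparse_pair_bound_le_exp_neg (n : ℕ) (p : ℝ) (hn : 0 < n)
    (hp : Real.log n / n ≤ p) (hp1 : p ≤ 1) (hy : 20 ≤ Real.log n ^ (0.1 : ℝ))
    (hL : 0 < Real.log n) (r : ℕ) (hr : (n : ℝ) / (2 * Real.log n ^ (0.4 : ℝ)) ≤ r) :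
    4 ^ n * (2 : ℝ) ^ ((n : ℝ) * Real.log n ^ (0.1 : ℝ)) * (1 - p / 2) ^ (r * r) ≤
      Real.exp (-n) := by
  set L := Real.log n with hLdef
  set y := L ^ (0.1 : ℝ) with hydef
  have hn' : (0 : ℝ) < n := by exact_mod_cast hn
  have hy0 : 0 < y := by linarith
  have hy4 : L ^ (0.4 : ℝ) = y ^ 4 := by
    rw [hydef, ← Real.rpow_natCast, ← Real.rpow_mul hL.le]; norm_num
  have hy10 : L = y ^ 10 := by
    rw [hydef, ← Real.rpow_natCast, ← Real.rpow_mul hL.le]; norm_num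
  have hp0 : 0 ≤ p := (div_pos hL hn').le.trans hp
  rw [hy4] at hr
  have hmain : n * y ^ 2 / 4 ≤ p * (r * r : ℕ) := by
    calc n * y ^ 2 / 4 = L / n * ((n / (2 * y ^ 4)) * (n / (2 * y ^ 4))) := by
          rw [hy10]; field_simp; norm_num
      _ ≤ p * ((r : ℝ) * r) := by gcongr
      _ = _ := by push_cast; ring
  have h1 : (1 - p / 2) ^ (r * r) ≤ Real.exp (-(n * y ^ 2 / 8)) := by
    calc (1 - p / 2) ^ (r * r) ≤ Real.exp (-(p / 2)) ^ (r * r) :=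
          pow_le_pow_left₀ (by linarith) (Real.one_sub_le_exp_neg _) _
      _ = Real.exp ((r * r : ℕ) * (-(p / 2))) := (Real.exp_nat_mul _ _).symm
      _ ≤ _ := Real.exp_le_exp.2 (by linarith)
  have h2 : (4 : ℝ) ^ n ≤ Real.exp (2 * n) := by
    have h4 : (4 : ℝ) ≤ Real.exp 2 := by
      have := Real.exp_one_gt_d9
      rw [show (2 : ℝ) = 1 + 1 by norm_num, Real.exp_add]
      nlinarith
    calc (4 : ℝ) ^ n ≤ Real.exp 2 ^ n := pow_le_pow_left₀ (by norm_num) h4 _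
      _ = _ := by rw [← Real.exp_nat_mul, mul_comm]
  have h3 : (2 : ℝ) ^ ((n : ℝ) * y) ≤ Real.exp (n * y) := by
    rw [← Real.exp_one_rpow]
    exact Real.rpow_le_rpow two_pos.le (by linarith [Real.exp_one_gt_d9]) (by positivity)
  calc _ ≤ Real.exp (2 * n) * Real.exp (n * y) * Real.exp (-(n * y ^ 2 / 8)) :=
        mul_le_mul (mul_le_mul h2 h3 (by positivity) (by positivity)) h1
          (pow_nonneg (by linarith) _) (by positivity)
    _ = Real.exp (n * (2 + y - y ^ 2 / 8)) := by
        rw [← Real.exp_add, ← Real.exp_add]; congr 1; ring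
    _ ≤ _ := Real.exp_le_exp.2 <| by
        have : 2 + y - y ^ 2 / 8 ≤ -1 := by nlinarith
        linarith [mul_le_mul_of_nonneg_left this hn'.le]

/-- If `ln n / n ≤ p(n) ≤ 1` for every `n` and
`r = r(n) = ⌈n/(2 (ln n)^{0.4})⌉`, then the probability that `G ~ G(n, p(n))` has a pair of
disjoint vertex sets `U, W` of size `r` each with `e_G(U,W) < n·(ln n)^{0.1}` tends to `0`
as `n → ∞`. -/
theorem stmt12 (p : ℕ → ℝ) (hp1 : ∀ n : ℕ, Real.log n / n ≤ p n) (hp2 : ∀ n : ℕ, p n ≤ 1) :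
    Tendsto (fun n : ℕ =>
        probGnp n (p n) {G | ∃ U W : Set (Fin n), Disjoint U W ∧
          U.ncard = ⌈(n : ℝ) / (2 * Real.log n ^ (0.4 : ℝ))⌉₊ ∧
          W.ncard = ⌈(n : ℝ) / (2 * Real.log n ^ (0.4 : ℝ))⌉₊ ∧
          (edgesBetween G U W : ℝ) < (n : ℝ) * Real.log n ^ (0.1 : ℝ)})
      atTop (nhds 0) := by
  have hlog : Tendsto (fun n : ℕ => Real.log n) atTop atTop :=
    Real.tendsto_log_atTop.comp tendsto_natCast_atTop_atTop
  have hpow : Tendsto (fun n : ℕ => Real.log n ^ (0.1 : ℝ)) atTop atTop :=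
    (tendsto_rpow_atTop (by norm_num)).comp hlog
  have hexp : Tendsto (fun n : ℕ => Real.exp (-(n : ℝ))) atTop (nhds 0) :=
    Real.tendsto_exp_neg_atTop_nhds_zero.comp tendsto_natCast_atTop_atTop
  have hp0 (n : ℕ) : 0 ≤ p n :=
    (div_nonneg (Real.log_natCast_nonneg n) n.cast_nonneg).trans (hp1 n)
  refine squeeze_zero' (Eventually.of_forall fun n => ?_) ?_ hexp
  · exact Finset.sum_nonneg fun G _ => Set.indicator_nonneg
      (fun G _ => mul_nonneg (pow_nonneg (hp0 n) _) (pow_nonneg (sub_nonneg.2 (hp2 n)) _)) G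
  · filter_upwards [eventually_gt_atTop 0, hpow.eventually_ge_atTop 20,
      hlog.eventually_gt_atTop 0] with n hn hy hL
    exact (probGnp_exists_sparse_pair_le n _ (p n) _ (hp0 n) (hp2 n)).trans
      (sparse_pair_bound_le_exp_neg n (p n) hn (hp1 n) (hp2 n) hy hL _ (Nat.le_ceil _))
end

section
/- Let k be a positive integer and let G = (V,E) be a finite graph that is an (R,c)-expander for a positive integer R and a real c with c ≥ k and R·c ≥ (|V|+k)/2. Then for every set S ⊆ V with |S| ≤ k−1, the graph obtained from G by deleting the vertices of S is connected; in particular G is k-vertex-connected. -/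
open SimpleGraph

/-- `G` is `k`-vertex-connected: it has more than `k` vertices and remains connected after
deleting any set of fewer than `k` vertices. -/
def KVertexConnected {V : Type*} [Fintype V] (G : SimpleGraph V) (k : ℕ) : Prop :=
  k < Fintype.card V ∧ ∀ S : Set V, S.ncard < k → (G.induce Sᶜ).Connected

/-- In an expander, a nonempty set with fewer than `k` external neighbors, all of them in a set `S`,
is large. -/
theorem IsExpander.half_le_ncard_add {V : Type*} [Finite V] {G : SimpleGraph V} {n k c : ℝ}
    {R : ℕ} (hk : 0 < k) (hc : k ≤ c) (hRc : (n + k) / 2 ≤ (R : ℝ) * c)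
    (hexp : IsExpander G (R : ℝ) c) {A S : Set V} (hA : A.Nonempty) (hS : (S.ncard : ℝ) < k)
    (hN : extNbhd G A ⊆ S) : (n + k) / 2 ≤ (A.ncard : ℝ) + S.ncard := by
  have hA1 : (1 : ℝ) ≤ A.ncard := by
    exact_mod_cast (Set.ncard_pos (Set.toFinite A)).2 hA
  rcases le_or_gt A.ncard R with h | h
  · have h1 := hexp A (by exact_mod_cast h)
    have h2 : ((extNbhd G A).ncard : ℝ) ≤ S.ncard := by
      exact_mod_cast Set.ncard_le_ncard hN (Set.toFinite S)
    nlinarith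
  · obtain ⟨B, hBA, hB⟩ := Set.exists_subset_card_eq h.le
    have h1 := hexp B (by rw [hB])
    have hsub : extNbhd G B ⊆ A ∪ S := by
      rintro v ⟨-, u, hu, huv⟩
      by_cases hv : v ∈ A
      · exact Or.inl hv
      · exact Or.inr (hN ⟨hv, u, hBA hu, huv⟩)
    have h2 : ((extNbhd G B).ncard : ℝ) ≤ A.ncard + S.ncard := by
      exact_mod_cast (Set.ncard_le_ncard hsub (Set.toFinite _)).trans (Set.ncard_union_le A S)
    rw [hB] at h1
    linarith

/-- If `G` is an `(R,c)`-expander with `c ≥ k` and `R·c ≥ (|V|+k)/2`,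
then deleting any set of at most `k-1` vertices leaves a connected graph; in particular
`G` is `k`-vertex-connected. -/
theorem stmt13 {V : Type*} [Fintype V] [Nonempty V] (G : SimpleGraph V) (k : ℕ) (hk : 0 < k)
    (R : ℕ) (hR : 0 < R) (c : ℝ) (hc : (k : ℝ) ≤ c)
    (hRc : ((Fintype.card V : ℝ) + k) / 2 ≤ (R : ℝ) * c)
    (hexp : IsExpander G (R : ℝ) c) :
    (∀ S : Set V, S.ncard ≤ k - 1 → (G.induce Sᶜ).Connected) ∧ KVertexConnected G k := by
  classical
  have hk' : (0 : ℝ) < k := by exact_mod_cast hk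
  have hcard : k < Fintype.card V := by
    obtain ⟨v⟩ := ‹Nonempty V›
    have h1 := hexp {v} (by rw [Set.ncard_singleton]; exact_mod_cast hR)
    rw [Set.ncard_singleton] at h1
    have h2 : k ≤ (extNbhd G {v}).ncard := by
      have : (k : ℝ) ≤ (extNbhd G {v}).ncard := by push_cast at h1; linarith
      exact_mod_cast this
    have h3 : (extNbhd G {v}).ncard < (Set.univ : Set V).ncard :=
      Set.ncard_lt_ncard ((Set.ssubset_univ_iff).2 fun h =>
        (h ▸ Set.mem_univ v : v ∈ extNbhd G {v}).1 rfl) (Set.toFinite _)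
    rw [Set.ncard_univ, Nat.card_eq_fintype_card] at h3
    omega
  have hconn : ∀ S : Set V, S.ncard < k → (G.induce Sᶜ).Connected := by
    intro S hS
    have hSc := Set.ncard_add_ncard_compl S
    rw [Nat.card_eq_fintype_card] at hSc
    have hne : (Sᶜ).Nonempty := (Set.ncard_pos (Set.toFinite _)).1 (by omega)
    have : Nonempty ↥(Sᶜ) := hne.to_subtype
    refine ⟨fun x y => ?_⟩
    by_contra hxy
    let A : Set V := {v | ∃ h : v ∈ Sᶜ, (G.induce Sᶜ).Reachable x ⟨v, h⟩}
    have hAS : A ⊆ Sᶜ := fun v ⟨h, _⟩ => h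
    have hstep : ∀ u ∈ A, ∀ v ∈ Sᶜ, G.Adj u v → v ∈ A := by
      rintro u ⟨hu, hxu⟩ v hv huv
      have hadj : (G.induce Sᶜ).Adj ⟨u, hu⟩ ⟨v, hv⟩ := huv
      exact ⟨hv, hxu.trans hadj.reachable⟩
    have hS' : (S.ncard : ℝ) < k := by exact_mod_cast hS
    have hA := hexp.half_le_ncard_add hk' hc hRc (A := A) ⟨x, x.2, .refl x⟩ hS' (by
      rintro v ⟨hv, u, hu, huv⟩
      by_contra hvS
      exact hv (hstep u hu v hvS huv))
    have hB := hexp.half_le_ncard_add hk' hc hRc (A := Sᶜ \ A)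
      ⟨y, y.2, fun ⟨_, h⟩ => hxy h⟩ hS' (by
      rintro v ⟨hv, u, hu, huv⟩
      by_contra hvS
      have hvA : v ∈ A := by
        by_contra h
        exact hv ⟨hvS, h⟩
      exact hu.2 (hstep v hvA u hu.1 huv.symm))
    have hsum := Set.ncard_sdiff_add_ncard_of_subset hAS (Set.toFinite _)
    have hsum' : ((Sᶜ \ A).ncard : ℝ) + A.ncard = (Sᶜ).ncard := by exact_mod_cast hsum
    have hSc' : (S.ncard : ℝ) + (Sᶜ).ncard = Fintype.card V := by exact_mod_cast hSc
    linarith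
  exact ⟨fun S hS => hconn S (by omega), hcard, hconn⟩
end

section
/- Let G = (V,E) be a finite graph that is an (R,c)-expander for a positive integer R and a real c ≥ 2 satisfying (c+1)·R ≤ |V| and |V| < 2Rc − 8c. Then for every nonempty set S ⊆ V, the number of connected components of the graph obtained from G by deleting the vertices of S is at most |S|. -/
open SimpleGraph

/-- The vertices outside `S` whose connected component in `G - S` belongs to `T`. -/
def componentUnion {V : Type*} (G : SimpleGraph V) (S : Set V)
    (T : Set (G.induce Sᶜ).ConnectedComponent) : Set V :=
  {v | ∃ h : v ∈ Sᶜ, (G.induce Sᶜ).connectedComponentMk ⟨v, h⟩ ∈ T}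

section componentUnion

variable {V : Type*} (G : SimpleGraph V) (S : Set V)

lemma disjoint_componentUnion (T : Set (G.induce Sᶜ).ConnectedComponent) :
    Disjoint S (componentUnion G S T) :=
  Set.disjoint_left.2 fun _ hv ⟨h, _⟩ => h hv

lemma extNbhd_subset_of_subset_componentUnion (T : Set (G.induce Sᶜ).ConnectedComponent)
    {A : Set V} (hA : A ⊆ componentUnion G S T) :
    extNbhd G A ⊆ (S ∪ componentUnion G S T) \ A := by
  rintro v ⟨hvA, u, huA, huv⟩
  refine ⟨?_, hvA⟩
  by_cases hv : v ∈ S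
  · exact Or.inl hv
  · obtain ⟨hu, huT⟩ := hA huA
    refine Or.inr ⟨hv, ?_⟩
    have hadj : (G.induce Sᶜ).Adj ⟨u, hu⟩ ⟨v, hv⟩ := huv
    rwa [← ConnectedComponent.connectedComponentMk_eq_of_adj hadj]

lemma ncard_extNbhd_add_ncard_le [Finite V] (T : Set (G.induce Sᶜ).ConnectedComponent)
    {A : Set V} (hA : A ⊆ componentUnion G S T) :
    (extNbhd G A).ncard + A.ncard ≤ S.ncard + (componentUnion G S T).ncard := by
  have h₁ := Set.ncard_le_ncard (extNbhd_subset_of_subset_componentUnion G S T hA)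
  have h₂ := Set.ncard_sdiff_add_ncard_of_subset (hA.trans (Set.subset_union_right (s := S)))
  have h₃ := Set.ncard_union_le S (componentUnion G S T)
  omega

lemma ncard_componentUnion_finset [Finite V]
    (T : Finset (G.induce Sᶜ).ConnectedComponent) :
    (componentUnion G S T).ncard = ∑ C ∈ T, (componentUnion G S {C}).ncard := by
  classical
  induction T using Finset.induction_on with
  | empty => simp [componentUnion]
  | insert C T hC ih =>
    rw [Finset.sum_insert hC, ← ih, ← Set.ncard_union_eq]
    · congr 1
      ext v
      simp only [componentUnion, Finset.coe_insert, Set.mem_insert_iff, Set.mem_ofPred_eq,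
        Set.mem_union, Set.mem_singleton_iff, ← exists_or]
    · rw [Set.disjoint_left]
      rintro v ⟨h, hv⟩ ⟨_, hv'⟩
      rw [Set.mem_singleton_iff.1 hv] at hv'
      exact hC hv'

lemma ncard_componentUnion_singleton_pos [Finite V]
    (C : (G.induce Sᶜ).ConnectedComponent) : 0 < (componentUnion G S {C}).ncard := by
  rw [Set.ncard_pos]
  obtain ⟨⟨v, hv⟩, rfl⟩ := C.exists_rep
  exact ⟨v, hv, rfl⟩

end componentUnion

lemma card_le_of_size_bounds {K : Type*} [Fintype K] (size : K → ℕ) (R s n : ℕ) (c : ℝ)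
    (hc : 2 ≤ c) (h1 : (c + 1) * R ≤ (n : ℝ)) (h2 : (n : ℝ) < 2 * R * c - 8 * c)
    (hs : 0 < s) (hpos : ∀ C, 0 < size C) (htotal : s + ∑ C, size C ≤ n)
    (hsmall : ∀ T : Finset K, ∑ C ∈ T, size C ≤ R → c * (∑ C ∈ T, size C : ℕ) ≤ s)
    (hlarge : ∀ C, R < size C → (c + 1) * R ≤ size C + s) :
    Fintype.card K ≤ s := by
  classical
  by_contra! hk
  have hR8 : (8 : ℝ) < R := by nlinarith
  have hs1 : (1 : ℝ) ≤ s := by exact_mod_cast hs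
  obtain ⟨W, hW, hmax⟩ := Finset.exists_max_image
    (Finset.univ.filter fun T : Finset K => ∑ C ∈ T, size C ≤ R) Finset.card
    ⟨∅, by simp⟩
  simp only [Finset.mem_filter, Finset.mem_univ, true_and] at hW hmax
  obtain ⟨x, hx⟩ : ∃ x : ℝ, (s : ℝ) = c * x := ⟨s / c, by field_simp⟩
  have hx_of {y : ℝ} (h : c * y ≤ s) : y ≤ x := by
    rw [hx] at h; exact le_of_mul_le_mul_left h (by linarith)
  have hx0 : 0 < x := pos_of_mul_pos_right (hx ▸ by linarith : 0 < c * x) (by linarith)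
  have hWx := hx_of (hsmall W hW)
  have hWcard : (W.card : ℝ) ≤ (∑ C ∈ W, size C : ℕ) := by
    exact_mod_cast (by simpa using Finset.card_nsmul_le_sum W size 1 fun C _ => hpos C)
  have hout : ∀ C ∈ Wᶜ, (R : ℝ) - x ≤ size C := by
    intro C hC
    rw [Finset.mem_compl] at hC
    have h : R < size C + ∑ D ∈ W, size D := by
      by_contra! h
      have := hmax (insert C W) (by rwa [Finset.sum_insert hC])
      rw [Finset.card_insert_of_notMem hC] at this
      omega
    have h' : (R : ℝ) < size C + (∑ D ∈ W, size D : ℕ) := by exact_mod_cast h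
    linarith
  have hcard : (W.card : ℝ) + (Wᶜ.card : ℝ) = Fintype.card K := by
    exact_mod_cast Finset.card_add_card_compl W
  have hk' : (s : ℝ) + 1 ≤ Fintype.card K := by exact_mod_cast hk
  have htotal' : (s : ℝ) + ∑ C, (size C : ℝ) ≤ n := by exact_mod_cast htotal
  have hKn : (Fintype.card K : ℝ) ≤ ∑ C, (size C : ℝ) := by
    exact_mod_cast (by simpa using Finset.card_nsmul_le_sum Finset.univ size 1 fun C _ => hpos C)
  have hxR : x ≤ R - 4 := by
    refine le_of_mul_le_mul_left (a := c) ?_ (by linarith)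
    linarith
  have hsum_le (T : Finset K) : ∑ C ∈ T, (size C : ℝ) ≤ ∑ C, (size C : ℝ) :=
    Finset.sum_le_sum_of_subset_of_nonneg (Finset.subset_univ T) fun _ _ _ => by positivity
  rcases le_or_gt 4 x with hx4 | hx4
  · have h₁ : (Wᶜ.card : ℝ) * (R - x) ≤ ∑ C ∈ Wᶜ, (size C : ℝ) := by
      simpa using Finset.card_nsmul_le_sum Wᶜ (fun C => (size C : ℝ)) _ hout
    have h₂ : (c - 1) * x ≤ Wᶜ.card := by linarith
    have h₃ := mul_le_mul_of_nonneg_right h₂ (by linarith : (0 : ℝ) ≤ R - x)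
    have h₄ : 4 * ((R : ℝ) - 4) ≤ x * (R - x) := by
      linarith [mul_nonneg (sub_nonneg.2 hx4) (sub_nonneg.2 hxR)]
    have h₅ := mul_le_mul_of_nonneg_left h₄ (by linarith : (0 : ℝ) ≤ c - 1)
    have h₆ := hsum_le Wᶜ
    have h₇ : 0 ≤ (c - 2) * ((R : ℝ) - 4) := mul_nonneg (by linarith) (by linarith)
    linarith
  · have hbig : ∀ C ∈ Wᶜ, (c + 1) * R ≤ size C + s := by
      intro C hC
      refine hlarge C ?_
      by_contra! h
      have := hx_of (by simpa using hsmall {C} (by simpa using h))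
      linarith [hout C hC]
    have hone : 1 < Wᶜ.card := by
      have h : (1 : ℝ) < Wᶜ.card := by
        have := mul_le_mul_of_nonneg_right hc hx0.le
        linarith
      exact_mod_cast h
    obtain ⟨C, hC, D, hD, hCD⟩ := Finset.one_lt_card.1 hone
    have h := hsum_le {C, D}
    rw [Finset.sum_pair hCD] at h
    linarith [hbig C hC, hbig D hD, mul_le_mul_of_nonneg_left hx4.le (by linarith : 0 ≤ c)]

/-- If `G` is an `(R,c)`-expander with `c ≥ 2`, `(c+1)·R ≤ |V|` and
`|V| < 2Rc - 8c`, then for every nonempty vertex set `S`, the graph obtained by deleting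
`S` has at most `|S|` connected components. -/
theorem stmt15 {V : Type*} [Fintype V] (G : SimpleGraph V) (R : ℕ) (hR : 0 < R) (c : ℝ)
    (hc : 2 ≤ c) (h1 : (c + 1) * R ≤ (Fintype.card V : ℝ))
    (h2 : (Fintype.card V : ℝ) < 2 * R * c - 8 * c)
    (hexp : IsExpander G (R : ℝ) c) :
    ∀ S : Set V, S.Nonempty →
      Nat.card (G.induce Sᶜ).ConnectedComponent ≤ S.ncard := by
  classical
  intro S hS
  have : Fintype (G.induce Sᶜ).ConnectedComponent := Fintype.ofFinite _
  rw [Nat.card_eq_fintype_card]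
  refine card_le_of_size_bounds (fun C => (componentUnion G S {C}).ncard) R S.ncard
    (Fintype.card V) c hc h1 h2 ((Set.ncard_pos).2 hS)
    (ncard_componentUnion_singleton_pos G S) ?_ ?_ ?_
  · rw [← ncard_componentUnion_finset, ← Set.ncard_union_eq (disjoint_componentUnion G S _),
      ← Nat.card_eq_fintype_card]
    exact Set.ncard_le_card _
  · intro T hT
    rw [← ncard_componentUnion_finset] at hT ⊢
    have h := ncard_extNbhd_add_ncard_le G S T subset_rfl
    have h' : (extNbhd G (componentUnion G S T)).ncard ≤ S.ncard := by omega
    exact (hexp _ (by exact_mod_cast hT)).trans (by exact_mod_cast h')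
  · intro C hC
    obtain ⟨A, hA, hAR⟩ := Set.exists_subset_card_eq hC.le
    have h : ((extNbhd G A).ncard : ℝ) + A.ncard ≤ S.ncard + (componentUnion G S {C}).ncard := by
      exact_mod_cast ncard_extNbhd_add_ncard_le G S {C} hA
    have h' := hexp A (by rw [hAR])
    rw [hAR] at h h'
    linarith
end

section
/- Let G = (V,E) be a finite graph that is an (R,c)-expander for a positive integer R and a real c ≥ 2 satisfying (c+1)·R ≤ |V| and |V| < 2Rc − 8c. Then G contains a matching of size ⌊|V|/2⌋; in particular, if |V| is even then G has a perfect matching. -/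
open SimpleGraph

section

open Finset

/-- A finite set whose edges leave it only into `T` expands into `T`. -/
lemma IsExpander.mul_card_le {V : Type*} {G : SimpleGraph V} {R c : ℝ}
    (h : IsExpander G R c) {U T : Finset V} (hU : (U.card : ℝ) ≤ R)
    (hT : ∀ u ∈ U, ∀ v, G.Adj u v → v ∈ U ∨ v ∈ T) : c * U.card ≤ T.card := by
  have key := h (U : Set V) (by simpa using hU)
  rw [Set.ncard_coe_finset] at key
  refine key.trans ?_
  rw [← Set.ncard_coe_finset T]
  refine Nat.cast_le.mpr (Set.ncard_le_ncard ?_ T.finite_toSet)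
  rintro v ⟨hv, u, hu, huv⟩
  exact (hT u hu v huv).resolve_left hv

/-- The numerical contradiction when the separator is small, so that all the components that are
not collected in the small part are very large. -/
lemma false_of_large_components {R c s m n : ℝ} (hc : 2 ≤ c) (hR : 1 ≤ R)
    (h2 : n < 2 * R * c - 8 * c) (hs : 2 * s < c * (R + 1))
    (h3 : 3 ≤ m ∨ 2 ≤ m ∧ s ≤ 2) (h : s + m * ((c + 1) * R - s) ≤ n) : False := by
  have hcR : c ≤ c * R := by nlinarith
  have hb : 0 ≤ (c + 1) * R - s := by nlinarith
  rcases h3 with h3 | ⟨h3, hs2⟩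
  · nlinarith [mul_le_mul_of_nonneg_right h3 hb]
  · nlinarith [mul_le_mul_of_nonneg_right h3 hb]

/-- The numerical contradiction when the separator is large. -/
lemma false_of_large_separator {R c x m n : ℝ} (hc : 2 ≤ c)
    (h2 : n < 2 * R * c - 8 * c) (hx : R + 1 ≤ 2 * x) (hn : 2 * (c * x) + 1 ≤ n)
    (hm : c * x + 1 - x ≤ m) (h : c * x + m * (R + 1 - x) ≤ n) : False := by
  have hxR : x < R - 4 := by
    by_contra! hcon
    nlinarith
  have hm' : c / 2 * x ≤ m := by nlinarith
  have h4 := mul_le_mul_of_nonneg_right hm' (show 0 ≤ R + 1 - x by linarith)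
  have h5 : 2 * R - 8 ≤ x + x * (R + 1 - x) / 2 := by
    nlinarith [mul_nonneg (show 0 ≤ 2 * x - (R + 1) by linarith)
      (show 0 ≤ R - 4 - x by linarith)]
  nlinarith [mul_le_mul_of_nonneg_left h5 (show 0 ≤ c by linarith)]

/-- In an expander, deleting a set `S` leaves at most `max 1 |S|` disjoint pieces with no edges
between them. -/
lemma IsExpander.card_components_le {V : Type*} [Fintype V] {G : SimpleGraph V} {R : ℕ} {c : ℝ}
    (hexp : IsExpander G (R : ℝ) c) (hR : 0 < R) (hc : 2 ≤ c)
    (h2 : (Fintype.card V : ℝ) < 2 * R * c - 8 * c)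
    {ι : Type*} [Fintype ι] (S : Finset V) (C : ι → Finset V)
    (hne : ∀ i, (C i).Nonempty) (hdisj : Pairwise fun i j => Disjoint (C i) (C j))
    (hS : ∀ i, Disjoint (C i) S) (hadj : ∀ i, ∀ u ∈ C i, ∀ v, G.Adj u v → v ∈ C i ∨ v ∈ S) :
    Fintype.card ι ≤ max 1 S.card := by
  classical
  by_contra! hk
  rw [max_lt_iff] at hk
  obtain ⟨hk1, hks⟩ := hk
  have hcardU (J : Finset ι) : (J.biUnion C).card = ∑ i ∈ J, (C i).card :=
    card_biUnion fun i _ j _ hij => hdisj hij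
  have hJle (J : Finset ι) : J.card ≤ ∑ i ∈ J, (C i).card := by
    rw [card_eq_sum_ones]
    exact sum_le_sum fun i _ => (hne i).card_pos
  have htot : S.card + ∑ i, (C i).card ≤ Fintype.card V := by
    rw [← hcardU, ← card_union_of_disjoint, ← card_univ]
    · exact card_le_card (subset_univ _)
    · rw [disjoint_biUnion_right]
      exact fun i _ => (hS i).symm
  have hexpU (J : Finset ι) (hJ : ∑ i ∈ J, (C i).card ≤ R) :
      c * (∑ i ∈ J, (C i).card : ℕ) ≤ S.card := by
    rw [← hcardU] at hJ ⊢
    refine hexp.mul_card_le (by exact_mod_cast hJ) fun u hu v huv => ?_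
    obtain ⟨i, hi, hui⟩ := mem_biUnion.mp hu
    exact (hadj i u hui v huv).imp_left fun h => mem_biUnion.mpr ⟨i, hi, h⟩
  obtain ⟨J, hJ⟩ := Set.Finite.exists_maximal
    (s := {J : Finset ι | ∑ i ∈ J, (C i).card ≤ R}) (Set.toFinite _) ⟨∅, by simp⟩
  have hJR : ∑ i ∈ J, (C i).card ≤ R := hJ.prop
  have hJmax (i : ι) (hi : i ∉ J) : R + 1 ≤ (C i).card + ∑ i ∈ J, (C i).card := by
    by_contra! hcon
    have hins : ∑ i ∈ insert i J, (C i).card ≤ R := by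
      rw [sum_insert hi]; lia
    exact hi (hJ.le_of_ge hins (subset_insert i J) (mem_insert_self i J))
  have hsplit : S.card + ∑ i ∈ Jᶜ, (C i).card ≤ Fintype.card V := by
    have := sum_add_sum_compl J fun i => (C i).card
    lia
  have hcardJ : (J.card : ℝ) + (Jᶜ.card : ℝ) = Fintype.card ι := by
    exact_mod_cast card_add_card_compl J
  have hUs := hexpU J hJR
  have hJU : (J.card : ℝ) ≤ (∑ i ∈ J, (C i).card : ℕ) := by exact_mod_cast hJle J
  have hbound (b : ℝ) (hb : ∀ i ∉ J, b ≤ (C i).card) :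
      S.card + (Jᶜ.card : ℝ) * b ≤ Fintype.card V := by
    have h3 : (S.card : ℝ) + ∑ i ∈ Jᶜ, ((C i).card : ℝ) ≤ Fintype.card V := by
      exact_mod_cast hsplit
    have h4 := card_nsmul_le_sum Jᶜ (fun i => ((C i).card : ℝ)) b fun i hi =>
      hb i (mem_compl.mp hi)
    rw [nsmul_eq_mul] at h4
    linarith
  have hsk : (S.card : ℝ) + 1 ≤ Fintype.card ι := by exact_mod_cast hks
  have hmax (i : ι) (hi : i ∉ J) :
      (R : ℝ) + 1 ≤ (C i).card + (∑ i ∈ J, (C i).card : ℕ) := by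
    exact_mod_cast hJmax i hi
  by_cases hs : 2 * (S.card : ℝ) < c * (R + 1)
  · have hlarge (i : ι) (hi : i ∉ J) : (c + 1) * R - S.card ≤ (C i).card := by
      have hiR : R ≤ (C i).card := by
        by_contra! hcon
        have h3 := hexpU {i} (by simpa using hcon.le)
        rw [sum_singleton] at h3
        nlinarith [hmax i hi]
      obtain ⟨W, hWC, hWR⟩ := exists_subset_card_eq hiR
      have h3 := hexp.mul_card_le (U := W) (T := (C i \ W) ∪ S) (by rw [hWR])
        fun u hu v huv => by
          have := hadj i u (hWC hu) v huv
          grind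
      have h4 : (((C i \ W) ∪ S).card : ℝ) ≤ (C i).card - R + S.card := by
        have h5 := card_union_le (C i \ W) S
        have h6 := card_sdiff_add_card_eq_card hWC
        rw [hWR] at h6
        have h7 : (((C i \ W) ∪ S).card : ℝ) ≤ (C i \ W).card + S.card := by exact_mod_cast h5
        have h8 : ((C i \ W).card : ℝ) + R = (C i).card := by exact_mod_cast h6
        linarith
      rw [hWR] at h3
      linarith
    have hJs : 2 * J.card ≤ S.card := by
      have : 2 * (J.card : ℝ) ≤ S.card := by nlinarith
      exact_mod_cast this
    have hJk := card_add_card_compl J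
    refine false_of_large_components (m := (Jᶜ.card : ℝ)) hc (by exact_mod_cast hR) h2 hs ?_
      (hbound _ hlarge)
    have h3 : 3 ≤ Jᶜ.card ∨ 2 ≤ Jᶜ.card ∧ S.card ≤ 2 := by lia
    exact_mod_cast h3
  · push Not at hs
    have hc0 : 0 < c := by linarith
    have hcx : c * (S.card / c : ℝ) = S.card := by field_simp
    have hUx : ((∑ i ∈ J, (C i).card : ℕ) : ℝ) ≤ S.card / c := by
      rw [le_div_iff₀ hc0]; linarith
    refine false_of_large_separator (x := S.card / c) (m := Jᶜ.card) hc h2 ?_ ?_ ?_ ?_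
    · nlinarith
    · rw [hcx]
      have h3 := hJle univ
      rw [card_univ] at h3
      have h4 : S.card + Fintype.card ι ≤ Fintype.card V := by lia
      have h5 : (S.card : ℝ) + Fintype.card ι ≤ Fintype.card V := by exact_mod_cast h4
      linarith
    · rw [hcx]; linarith
    · rw [hcx]
      exact hbound _ fun i hi => by linarith [hmax i hi]

/-- If a graph on an even number of vertices has no perfect matching, then the number of odd
components left by some set of vertices exceeds its size by at least two. -/
lemma SimpleGraph.exists_ncard_add_two_le_oddComponents {W : Type*} [Finite W]
    (H : SimpleGraph W) (hW : Even (Nat.card W)) (h : ∀ M : H.Subgraph, ¬ M.IsPerfectMatching) :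
    ∃ u : Set W, u.ncard + 2 ≤ ((⊤ : H.Subgraph).deleteVerts u).coe.oddComponents.ncard := by
  obtain ⟨u, hu⟩ := exists_isTutteViolator h hW
  refine ⟨u, ?_⟩
  have hodd := odd_ncard_oddComponents (G := ((⊤ : H.Subgraph).deleteVerts u).coe)
  have hcard : Nat.card ((⊤ : H.Subgraph).deleteVerts u).verts + u.ncard = Nat.card W := by
    rw [Nat.card_coe_set_eq, Subgraph.deleteVerts_verts, Subgraph.verts_top,
      ← Set.compl_eq_univ_sdiff, add_comm, Set.ncard_add_ncard_compl]
  unfold IsTutteViolator at hu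
  grind

/-- In an expander, every even set of vertices missing at most one vertex can be matched. -/
lemma IsExpander.exists_isMatching_verts_eq {V : Type*} [Fintype V] {G : SimpleGraph V} {R : ℕ}
    {c : ℝ} (hexp : IsExpander G (R : ℝ) c) (hR : 0 < R) (hc : 2 ≤ c)
    (h2 : (Fintype.card V : ℝ) < 2 * R * c - 8 * c) (W : Set V) (hW : Even W.ncard)
    (hWc : Wᶜ.ncard ≤ 1) : ∃ M : G.Subgraph, M.IsMatching ∧ M.verts = W := by
  classical
  by_cases hM : ∃ M : (G.induce W).Subgraph, M.IsPerfectMatching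
  · obtain ⟨M, hM, hMs⟩ := hM
    refine ⟨M.map (Embedding.induce W).toHom, hM.map _ Subtype.val_injective, ?_⟩
    rw [Subgraph.map_verts, hMs.verts_eq_univ, Set.image_univ]
    exact Subtype.range_coe
  push Not at hM
  obtain ⟨u, hu⟩ := exists_ncard_add_two_le_oddComponents (G.induce W)
    (by rwa [Nat.card_coe_set_eq]) hM
  set D := (⊤ : (G.induce W).Subgraph).deleteVerts u
  let S : Set V := Wᶜ ∪ (↑) '' u
  let C (K : D.coe.oddComponents) : Set V := (fun x : D.verts => (x : V)) '' K.1.supp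
  have hinj : Function.Injective (fun x : D.verts => (x : V)) :=
    Subtype.val_injective.comp Subtype.val_injective
  have hmem (x : D.verts) : (x : W) ∉ u := x.2.2
  have key := hexp.card_components_le hR hc h2 S.toFinset (fun K => (C K).toFinset)
    (fun K => by simpa [C] using K.1.nonempty_supp)
    (fun K L hKL => by
      dsimp only
      rw [Set.disjoint_toFinset]
      refine (Set.disjoint_image_iff hinj).mpr ?_
      exact pairwise_disjoint_supp_connectedComponent _
        fun h => hKL (Subtype.ext h))
    (fun K => by
      rw [Set.disjoint_toFinset, Set.disjoint_left]
      rintro _ ⟨x, hx, rfl⟩ (h | ⟨y, hy, hyx⟩)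
      · exact h x.1.2
      · exact hmem x (Subtype.ext hyx ▸ hy))
    (fun K a ha b hab => by
      rw [Set.mem_toFinset] at ha
      simp only [Set.mem_toFinset]
      obtain ⟨x, hx, rfl⟩ := ha
      by_contra! hcon
      obtain ⟨hbC, hbS⟩ := hcon
      have hbW : b ∈ W := by
        by_contra h
        exact hbS (.inl h)
      have hbu : (⟨b, hbW⟩ : W) ∉ u := fun h => hbS (.inr ⟨_, h, rfl⟩)
      let y : D.verts := ⟨⟨b, hbW⟩, ⟨trivial, hbu⟩⟩
      have hxy : D.coe.Adj x y :=
        Subgraph.deleteVerts_adj.mpr ⟨trivial, hmem x, trivial, hbu, hab⟩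
      exact hbC ⟨y, K.1.mem_supp_of_adj_mem_supp hx hxy, rfl⟩)
  have hScard : S.toFinset.card ≤ 1 + u.ncard := by
    rw [← Set.ncard_eq_toFinset_card']
    refine (Set.ncard_union_le _ _).trans (add_le_add hWc ?_)
    exact Set.ncard_image_le
  rw [← Nat.card_eq_fintype_card, Nat.card_coe_set_eq] at key
  lia

/-- A matching covers twice as many vertices as it has edges. -/
lemma SimpleGraph.Subgraph.IsMatching.two_mul_ncard_edgeSet {V : Type*} [Finite V]
    {G : SimpleGraph V} {M : G.Subgraph} (hM : M.IsMatching) :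
    2 * M.edgeSet.ncard = M.verts.ncard := by
  classical
  cases nonempty_fintype V
  have h := M.coe.sum_degrees_eq_twice_card_edges
  rw [sum_eq_card_nsmul (b := 1) fun v _ => by
    rw [Subgraph.coe_degree]
    convert Subgraph.isMatching_iff_forall_degree.mp hM v v.2] at h
  rw [card_univ, smul_eq_mul, mul_one] at h
  rw [← Subgraph.image_coe_edgeSet_coe,
    Set.ncard_image_of_injective _ (Sym2.map.injective Subtype.val_injective),
    ← Nat.card_coe_set_eq M.verts, Nat.card_eq_fintype_card, h, ← coe_edgeFinset,
    Set.ncard_coe_finset]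

end

/-- If `G` is an `(R,c)`-expander with `c ≥ 2`, `(c+1)·R ≤ |V|` and
`|V| < 2Rc - 8c`, then `G` contains a matching with `⌊|V|/2⌋` edges; in particular, if
`|V|` is even then `G` has a perfect matching. -/
theorem stmt16 {V : Type*} [Fintype V] (G : SimpleGraph V) (R : ℕ) (hR : 0 < R) (c : ℝ)
    (hc : 2 ≤ c) (h1 : (c + 1) * R ≤ (Fintype.card V : ℝ))
    (h2 : (Fintype.card V : ℝ) < 2 * R * c - 8 * c)
    (hexp : IsExpander G (R : ℝ) c) :
    (∃ M : G.Subgraph, M.IsMatching ∧ M.edgeSet.ncard = Fintype.card V / 2) ∧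
    (Even (Fintype.card V) → ∃ M : G.Subgraph, M.IsPerfectMatching) := by
  obtain ⟨W, hWeven, hWc⟩ : ∃ W : Set V, Even W.ncard ∧ Wᶜ.ncard = Fintype.card V % 2 := by
    obtain ⟨T, -, hT⟩ := Set.exists_subset_card_eq (s := (Set.univ : Set V))
      (n := Fintype.card V % 2) (by
        rw [Set.ncard_univ, Nat.card_eq_fintype_card]
        exact Nat.mod_le _ _)
    refine ⟨Tᶜ, ?_, by rwa [compl_compl]⟩
    have := Set.ncard_add_ncard_compl T
    rw [Nat.card_eq_fintype_card] at this
    grind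
  obtain ⟨M, hM, hMW⟩ := hexp.exists_isMatching_verts_eq hR hc h2 W hWeven (by lia)
  have hcard := Set.ncard_add_ncard_compl W
  rw [Nat.card_eq_fintype_card] at hcard
  have hedges := hM.two_mul_ncard_edgeSet
  rw [hMW] at hedges
  refine ⟨⟨M, hM, by lia⟩, fun heven => ⟨M, hM, ?_⟩⟩
  rw [Nat.even_iff.mp heven, Set.ncard_eq_zero, Set.compl_empty_iff] at hWc
  rw [Subgraph.isSpanning_iff, hMW, hWc]
end

section
/- Let G = (V,E) be a finite connected graph that is an (R,2)-expander for a positive integer R, and suppose G is not Hamiltonian. Then the number of boosters with respect to G satisfies |B_G| ≥ R²/2. -/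
open SimpleGraph

/-- The length of a longest path in `G`. -/
noncomputable def maxPathLen {V : Type*} (G : SimpleGraph V) : ℕ :=
  sSup {n | ∃ (u w : V) (p : G.Walk u w), p.IsPath ∧ p.length = n}

/-- The set of boosters with respect to `G`: non-edges `{u,v}` whose addition either makes
the graph Hamiltonian or strictly increases the length of a longest path. -/
def boosters {V : Type*} [Fintype V] [DecidableEq V] (G : SimpleGraph V) : Set (Sym2 V) :=
  {e | ¬e.IsDiag ∧ e ∉ G.edgeSet ∧
    ((G ⊔ SimpleGraph.fromEdgeSet {e}).IsHamiltonian ∨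
      maxPathLen G < maxPathLen (G ⊔ SimpleGraph.fromEdgeSet {e}))}

/-- `f 0, f 1, …, f n` are the successive vertices of a path of length `n` in `G`. -/
structure IsPathSeq {V : Type*} (G : SimpleGraph V) (n : ℕ) (f : ℕ → V) : Prop where
  adj : ∀ i < n, G.Adj (f i) (f (i + 1))
  inj : ∀ i ≤ n, ∀ j ≤ n, f i = f j → i = j

/-- `y` and `w` are consecutive on the path `f 0, …, f n`. -/
def SeqLink {V : Type*} (n : ℕ) (f : ℕ → V) (y w : V) : Prop :=
  ∃ i < n, (f i = y ∧ f (i + 1) = w) ∨ (f i = w ∧ f (i + 1) = y)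

/-- Reversal of the first `k` terms of a sequence. -/
def rotateSeq {V : Type*} (f : ℕ → V) (k : ℕ) (i : ℕ) : V :=
  if i < k then f (k - 1 - i) else f i

/-- `g` is obtained from `f` by one Pósa rotation fixing the last vertex `f n`. -/
def RotationStep {V : Type*} (G : SimpleGraph V) (n : ℕ) (f g : ℕ → V) : Prop :=
  ∃ k, 1 ≤ k ∧ k ≤ n ∧ G.Adj (f 0) (f k) ∧ g = rotateSeq f k

/-- The set of initial vertices of paths obtained from `f` by Pósa rotations fixing `f n`. -/
def rotationEnds {V : Type*} (G : SimpleGraph V) (n : ℕ) (f : ℕ → V) : Set V :=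
  {x | ∃ g, Relation.ReflTransGen (RotationStep G n) f g ∧ g 0 = x}

section PathSeq

variable {V : Type*} {G : SimpleGraph V} {n : ℕ} {f g : ℕ → V}

lemma IsPathSeq.mono {H : SimpleGraph V} (hf : IsPathSeq G n f) (h : G ≤ H) :
    IsPathSeq H n f :=
  ⟨fun i hi => h (hf.adj i hi), hf.inj⟩

lemma IsPathSeq.rotateSeq (hf : IsPathSeq G n f) {k : ℕ} (hkn : k ≤ n)
    (ha : G.Adj (f 0) (f k)) : IsPathSeq G n (rotateSeq f k) := by
  refine ⟨fun i hi => ?_, fun i hi j hj h => ?_⟩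
  · unfold _root_.rotateSeq
    rcases lt_trichotomy (i + 1) k with h | h | h
    · rw [if_pos (by omega), if_pos h]
      have := hf.adj (k - 1 - (i + 1)) (by omega)
      rw [show k - 1 - (i + 1) + 1 = k - 1 - i by omega] at this
      exact this.symm
    · rw [if_pos (by omega), if_neg (by omega)]
      rwa [show k - 1 - i = 0 by omega, h]
    · rw [if_neg (by omega), if_neg (by omega)]
      exact hf.adj i hi
  · unfold _root_.rotateSeq at h
    split_ifs at h with h1 h2 h2 <;>
    · have := hf.inj _ (by omega) _ (by omega) h
      omega

lemma IsPathSeq.reverse (hf : IsPathSeq G n f) : IsPathSeq G n (fun i => f (n - i)) := by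
  refine ⟨fun i hi => ?_, fun i hi j hj h => ?_⟩
  · have := hf.adj (n - (i + 1)) (by omega)
    rw [show n - (i + 1) + 1 = n - i by omega] at this
    exact this.symm
  · have := hf.inj _ (by omega) _ (by omega) h
    omega

lemma IsPathSeq.prepend (hf : IsPathSeq G n f) {v : V} (hv : G.Adj v (f 0))
    (hnot : ∀ i ≤ n, f i ≠ v) : IsPathSeq G (n + 1) (fun i => if i = 0 then v else f (i - 1)) := by
  refine ⟨fun i hi => ?_, fun i hi j hj h => ?_⟩
  · rcases i with _ | i
    · simpa using hv
    · simpa using hf.adj i (by omega)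
  · rcases i with _ | i <;> rcases j with _ | j
    · rfl
    · simp only [if_pos, Nat.add_one_ne_zero, if_false, Nat.add_sub_cancel] at h
      exact absurd h.symm (hnot j (by omega))
    · simp only [if_pos, Nat.add_one_ne_zero, if_false, Nat.add_sub_cancel] at h
      exact absurd h (hnot i (by omega))
    · simp only [Nat.add_one_ne_zero, if_false, Nat.add_sub_cancel] at h
      rw [hf.inj i (by omega) j (by omega) h]

lemma IsPathSeq.cycleShift (hf : IsPathSeq G n f) (ha : G.Adj (f n) (f 0)) {k : ℕ} (hk : k ≤ n) :
    IsPathSeq G n (fun i => if i + k ≤ n then f (i + k) else f (i + k - (n + 1))) := by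
  refine ⟨fun i hi => ?_, fun i hi j hj h => ?_⟩
  · rcases lt_trichotomy (i + k) n with h | h | h
    · rw [if_pos (by omega), if_pos (by omega), show i + 1 + k = i + k + 1 by omega]
      exact hf.adj _ h
    · rw [if_pos (by omega), if_neg (by omega), h, show i + 1 + k - (n + 1) = 0 by omega]
      exact ha
    · rw [if_neg (by omega), if_neg (by omega),
        show i + 1 + k - (n + 1) = i + k - (n + 1) + 1 by omega]
      exact hf.adj _ (by omega)
  · split_ifs at h with h1 h2 h2 <;>
    · have := hf.inj _ (by omega) _ (by omega) h
      omega

lemma IsPathSeq.exists_walk (hf : ∀ i < n, G.Adj (f i) (f (i + 1))) :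
    ∃ p : G.Walk (f 0) (f n), p.length = n ∧ ∀ i ≤ n, p.getVert i = f i := by
  induction n generalizing f with
  | zero => exact ⟨.nil, rfl, fun i hi => by simp [Nat.le_zero.1 hi]⟩
  | succ n ih =>
    obtain ⟨p, hp, hv⟩ := ih (f := fun i => f (i + 1)) (fun i hi => hf (i + 1) (by omega))
    refine ⟨.cons (hf 0 (by omega)) p, by simp [hp], fun i hi => ?_⟩
    rcases i with _ | i
    · simp
    · simpa using hv i (by omega)

lemma IsPathSeq.exists_path (hf : IsPathSeq G n f) :
    ∃ p : G.Walk (f 0) (f n), p.IsPath ∧ p.length = n ∧ ∀ i ≤ n, p.getVert i = f i := by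
  obtain ⟨p, hp, hv⟩ := IsPathSeq.exists_walk hf.adj
  refine ⟨p, ?_, hp, hv⟩
  rw [← Walk.IsPath.getVert_injOn_iff]
  intro i hi j hj h
  simp only [Set.mem_ofPred_eq, hp] at hi hj
  rw [hv i hi, hv j hj] at h
  exact hf.inj i hi j hj h

lemma IsPathSeq.of_isPath {u w : V} {p : G.Walk u w} (hp : p.IsPath) :
    IsPathSeq G p.length p.getVert :=
  ⟨fun _ hi => p.adj_getVert_succ hi, fun _ hi _ hj h => hp.getVert_injOn hi hj h⟩

lemma bddAbove_pathLengths [Fintype V] (G : SimpleGraph V) :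
    BddAbove {n | ∃ (u w : V) (p : G.Walk u w), p.IsPath ∧ p.length = n} := by
  refine ⟨Fintype.card V, ?_⟩
  rintro n ⟨u, w, p, hp, rfl⟩
  exact hp.length_lt.le

lemma IsPathSeq.le_maxPathLen [Fintype V] (hf : IsPathSeq G n f) : n ≤ maxPathLen G := by
  obtain ⟨p, hp, hl, -⟩ := hf.exists_path
  exact le_csSup (bddAbove_pathLengths G) ⟨_, _, p, hp, hl⟩

lemma exists_isPathSeq_maxPathLen [Fintype V] [Nonempty V] (G : SimpleGraph V) :
    ∃ f, IsPathSeq G (maxPathLen G) f := by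
  obtain ⟨v⟩ := ‹Nonempty V›
  have hne : {n | ∃ (u w : V) (p : G.Walk u w), p.IsPath ∧ p.length = n}.Nonempty :=
    ⟨0, v, v, .nil, by simp, rfl⟩
  obtain ⟨u, w, p, hp, hl⟩ := Nat.sSup_mem hne (bddAbove_pathLengths G)
  refine ⟨p.getVert, ?_⟩
  have := IsPathSeq.of_isPath hp
  rwa [hl] at this

/-- If the ends of a path of length at least two are adjacent, then the graph is Hamiltonian
or has a longer path. -/
lemma IsPathSeq.isHamiltonian_or_lt [Fintype V] [DecidableEq V] (hf : IsPathSeq G n f)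
    (hn : 2 ≤ n) (hG : G.Connected) (ha : G.Adj (f n) (f 0)) :
    G.IsHamiltonian ∨ n < maxPathLen G := by
  by_cases hcov : ∀ v, ∃ i ≤ n, f i = v
  · left
    intro _
    obtain ⟨p, hp, hl, hv⟩ := hf.exists_path
    refine ⟨f n, .cons ha p, ?_⟩
    constructor
    · rw [Walk.isCycle_iff_isPath_tail_and_le_length]
      constructor
      · simpa using hp
      · simp [hl]; omega
    · have : p.IsHamiltonian := by
        rw [hp.isHamiltonian_iff]
        intro v
        obtain ⟨i, hi, rfl⟩ := hcov v
        rw [← hv i hi]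
        exact p.getVert_mem_support i
      simpa [Walk.IsHamiltonian] using this
  · right
    push Not at hcov
    obtain ⟨v, hv⟩ := hcov
    obtain ⟨p⟩ := hG.preconnected (f 0) v
    obtain ⟨d, -, ⟨k, hk, hd⟩, h2⟩ := p.exists_boundary_dart {x | ∃ i ≤ n, f i = x}
      ⟨0, by omega, rfl⟩ (by rintro ⟨i, hi, h⟩; exact hv i hi h)
    have hshift := hf.cycleShift ha hk
    have := hshift.prepend (v := d.snd)
      (by simpa [hk, hd] using d.adj.symm) (by
        intro i hi h
        apply h2
        split_ifs at h with h1
        · exact ⟨_, h1, h⟩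
        · exact ⟨_, by omega, h⟩)
    exact this.le_maxPathLen

lemma IsPathSeq.of_rotation (hf : IsPathSeq G n f)
    (h : Relation.ReflTransGen (RotationStep G n) f g) :
    IsPathSeq G n g ∧ g n = f n ∧ ∀ i ≤ n, ∃ j ≤ n, f j = g i := by
  induction h with
  | refl => exact ⟨hf, rfl, fun i hi => ⟨i, hi, rfl⟩⟩
  | tail _ hs ih =>
    obtain ⟨k, hk, hkn, ha, rfl⟩ := hs
    obtain ⟨h1, h2, h3⟩ := ih
    refine ⟨h1.rotateSeq hkn ha, ?_, fun i hi => ?_⟩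
    · rw [← h2, _root_.rotateSeq, if_neg (by omega)]
    · unfold _root_.rotateSeq
      split_ifs
      · exact h3 _ (by omega)
      · exact h3 _ hi

lemma seqLink_rotateSeq_iff {k : ℕ} (hkn : k ≤ n) {y w : V}
    (h0 : y ≠ f 0) (h1 : y ≠ f (k - 1)) (h2 : y ≠ f k) :
    SeqLink n (rotateSeq f k) y w ↔ SeqLink n f y w := by
  unfold SeqLink rotateSeq
  constructor <;> rintro ⟨i, hi, h⟩ <;> rcases lt_trichotomy (i + 1) k with hlt | heq | hgt
  · rw [if_pos (by omega), if_pos hlt] at h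
    refine ⟨k - 1 - (i + 1), by omega, ?_⟩
    rw [show k - 1 - (i + 1) + 1 = k - 1 - i by omega]
    tauto
  · rw [if_pos (by omega), if_neg (by omega), show k - 1 - i = 0 by omega, heq] at h
    rcases h with ⟨h, -⟩ | ⟨-, h⟩
    · exact absurd h.symm h0
    · exact absurd h.symm h2
  · rw [if_neg (by omega), if_neg (by omega)] at h
    exact ⟨i, hi, h⟩
  · refine ⟨k - 1 - (i + 1), by omega, ?_⟩
    rw [if_pos (by omega), if_pos (by omega), show k - 1 - (k - 1 - (i + 1)) = i + 1 by omega,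
      show k - 1 - (k - 1 - (i + 1) + 1) = i by omega]
    tauto
  · rw [heq, show i = k - 1 by omega] at h
    rcases h with ⟨h, -⟩ | ⟨-, h⟩
    · exact absurd h.symm h1
    · exact absurd h.symm h2
  · refine ⟨i, hi, ?_⟩
    rwa [if_neg (by omega), if_neg (by omega)]

lemma mem_rotationEnds_of_adj (hg : Relation.ReflTransGen (RotationStep G n) f g) {k : ℕ}
    (hk : 1 ≤ k) (hkn : k ≤ n) (ha : G.Adj (g 0) (g k)) : g (k - 1) ∈ rotationEnds G n f := by
  refine ⟨rotateSeq g k, hg.tail ⟨k, hk, hkn, ha, rfl⟩, ?_⟩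
  rw [rotateSeq, if_pos (by omega), Nat.sub_zero]

lemma seqLink_pred {k : ℕ} (hk : 1 ≤ k) (hkn : k ≤ n) : SeqLink n f (f k) (f (k - 1)) :=
  ⟨k - 1, by omega, .inr ⟨rfl, by rw [Nat.sub_add_cancel hk]⟩⟩

/-- Rotations do not break path edges at a vertex that is far from all rotation ends. -/
lemma seqLink_iff_of_rotation {y : V} (hy : y ∉ rotationEnds G n f)
    (hw : ∀ w, SeqLink n f y w → w ∉ rotationEnds G n f)
    (h : Relation.ReflTransGen (RotationStep G n) f g) (w : V) :
    SeqLink n g y w ↔ SeqLink n f y w := by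
  induction h generalizing w with
  | refl => rfl
  | @tail g g' hg hs ih =>
    obtain ⟨k, hk, hkn, ha, rfl⟩ := hs
    have hend := mem_rotationEnds_of_adj hg hk hkn ha
    rw [seqLink_rotateSeq_iff hkn, ih]
    · rintro rfl
      exact hy ⟨g, hg, rfl⟩
    · rintro rfl
      exact hy hend
    · rintro rfl
      exact hw _ ((ih _).1 (seqLink_pred hk hkn)) hend

/-- All neighbors of the first vertex of a longest path are on the path. -/
lemma IsPathSeq.exists_eq_of_adj [Fintype V] (hf : IsPathSeq G n f) (hn : n = maxPathLen G)
    {y : V} (ha : G.Adj (f 0) y) : ∃ k, 1 ≤ k ∧ k ≤ n ∧ f k = y := by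
  by_contra! hcon
  have := (hf.prepend ha.symm (by
    intro i hi h
    rcases Nat.eq_zero_or_pos i with rfl | hpos
    · exact ha.ne h
    · exact hcon i hpos hi h)).le_maxPathLen
  omega

/-- Pósa's lemma: every external neighbor of the set of rotation ends is consecutive on the
original path to a rotation end. -/
lemma IsPathSeq.exists_seqLink_of_mem_extNbhd [Fintype V] (hf : IsPathSeq G n f)
    (hn : n = maxPathLen G) {y : V} (hy : y ∈ extNbhd G (rotationEnds G n f)) :
    ∃ w ∈ rotationEnds G n f, SeqLink n f y w := by
  obtain ⟨hyS, x, ⟨g, hg, rfl⟩, hxy⟩ := hy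
  by_contra! hcon
  obtain ⟨k, hk, hkn, rfl⟩ := (hf.of_rotation hg).1.exists_eq_of_adj hn hxy
  have hend := mem_rotationEnds_of_adj hg hk hkn hxy
  refine hcon _ hend ((seqLink_iff_of_rotation hyS (fun w h1 h2 => hcon w h2 h1) hg _).1 ?_)
  exact seqLink_pred hk hkn

lemma IsPathSeq.ncard_extNbhd_lt [Fintype V] (hf : IsPathSeq G n f) (hn : n = maxPathLen G) :
    (extNbhd G (rotationEnds G n f)).ncard < 2 * (rotationEnds G n f).ncard := by
  classical
  set S := rotationEnds G n f with hS
  let T : Finset ℕ := (Finset.range (n + 1)).filter (fun i => f i ∈ S)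
  have hT0 : 0 ∈ T := by
    simp only [T, Finset.mem_filter, Finset.mem_range]
    exact ⟨by omega, f, .refl, rfl⟩
  have hTS : T.card ≤ S.ncard := by
    rw [← Set.ncard_coe_finset]
    refine Set.ncard_le_ncard_of_injOn f ?_ ?_ S.toFinite
    · intro i hi
      exact (Finset.mem_filter.1 hi).2
    · intro i hi j hj h
      have hi' := Finset.mem_range.1 (Finset.mem_filter.1 hi).1
      have hj' := Finset.mem_range.1 (Finset.mem_filter.1 hj).1
      exact hf.inj i (by omega) j (by omega) h
  have hsub : extNbhd G S ⊆
      ((T.image (· + 1) ∪ (T.erase 0).image (· - 1)).image f : Finset V) := by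
    intro y hy
    obtain ⟨w, hw, i, hi, h⟩ := hf.exists_seqLink_of_mem_extNbhd hn hy
    simp only [Finset.coe_image, Set.mem_image, Finset.mem_coe, Finset.mem_union,
      Finset.mem_image, Finset.mem_erase]
    rcases h with ⟨h1, h2⟩ | ⟨h1, h2⟩
    · refine ⟨i, .inr ⟨i + 1, ⟨by omega, ?_⟩, by omega⟩, h1⟩
      exact Finset.mem_filter.2 ⟨Finset.mem_range.2 (by omega), h2 ▸ hw⟩
    · refine ⟨i + 1, .inl ⟨i, ?_, rfl⟩, h2⟩
      exact Finset.mem_filter.2 ⟨Finset.mem_range.2 (by omega), h1 ▸ hw⟩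
  have h1 := Set.ncard_le_ncard hsub (Finset.finite_toSet _)
  rw [Set.ncard_coe_finset] at h1
  have h2 : ((T.image (· + 1) ∪ (T.erase 0).image (· - 1)).image f).card
      ≤ T.card + (T.erase 0).card :=
    Finset.card_image_le.trans ((Finset.card_union_le _ _).trans
      (add_le_add Finset.card_image_le Finset.card_image_le))
  have h3 := Finset.card_erase_of_mem hT0
  have h4 : 0 < T.card := Finset.card_pos.2 ⟨0, hT0⟩
  omega

lemma IsPathSeq.lt_ncard_rotationEnds [Fintype V] {R : ℕ} (hf : IsPathSeq G n f)
    (hn : n = maxPathLen G) (hexp : IsExpander G (R : ℝ) 2) :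
    R < (rotationEnds G n f).ncard := by
  by_contra! h
  have h1 := hexp (rotationEnds G n f) (by exact_mod_cast h)
  have h2 := hf.ncard_extNbhd_lt hn
  have h3 : 2 * (rotationEnds G n f).ncard ≤ (extNbhd G (rotationEnds G n f)).ncard := by
    exact_mod_cast h1
  omega

/-- In an expander, longest paths have at least two edges. -/
lemma IsPathSeq.two_le [Fintype V] {R : ℕ} (hR : 0 < R) (hf : IsPathSeq G n f)
    (hn : n = maxPathLen G) (hexp : IsExpander G (R : ℝ) 2) : 2 ≤ n := by
  classical
  have h1 := hexp {f 0} (by rw [Set.ncard_singleton]; exact_mod_cast hR)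
  rw [Set.ncard_singleton] at h1
  have h2 : 2 ≤ (extNbhd G {f 0}).ncard := by
    have : (2 : ℝ) ≤ ((extNbhd G {f 0}).ncard : ℝ) := by simpa using h1
    exact_mod_cast this
  have hsub : extNbhd G {f 0} ⊆ ((Finset.Icc 1 n).image f : Finset V) := by
    rintro y ⟨-, u, rfl, ha⟩
    obtain ⟨k, hk, hkn, rfl⟩ := hf.exists_eq_of_adj hn ha
    simpa using ⟨k, ⟨hk, hkn⟩, rfl⟩
  have h3 := Set.ncard_le_ncard hsub (Finset.finite_toSet _)
  rw [Set.ncard_coe_finset] at h3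
  have h4 := h3.trans Finset.card_image_le
  rw [Nat.card_Icc] at h4
  omega

/-- In a connected non-Hamiltonian graph the ends of a longest path form a booster. -/
lemma IsPathSeq.mk_mem_boosters [Fintype V] [DecidableEq V] (hf : IsPathSeq G n f)
    (hn : n = maxPathLen G) (h2 : 2 ≤ n) (hG : G.Connected) (hham : ¬G.IsHamiltonian) :
    s(f n, f 0) ∈ boosters G := by
  have hne : f n ≠ f 0 := fun h => by
    have := hf.inj n le_rfl 0 (by omega) h
    omega
  refine ⟨by simpa using hne, fun ha => ?_, ?_⟩
  · rcases hf.isHamiltonian_or_lt h2 hG ha with h | h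
    · exact hham h
    · omega
  · have hle : G ≤ G ⊔ SimpleGraph.fromEdgeSet {s(f n, f 0)} := le_sup_left
    rw [← hn]
    exact (hf.mono hle).isHamiltonian_or_lt h2 (hG.mono hle) (by simp [hne])

end PathSeq

/-- A symmetric-pair count: at least `m` choices of `a` with at least `m` partners each give
at least `m ^ 2 / 2` unordered pairs. -/
lemma sq_le_two_mul_ncard_of_pairs {V : Type*} [Finite V] {B : Set (Sym2 V)} {m : ℕ} {A : Set V}
    (hA : m ≤ A.ncard) (T : V → Set V) (hT : ∀ a ∈ A, m ≤ (T a).ncard)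
    (hB : ∀ a ∈ A, ∀ b ∈ T a, s(a, b) ∈ B) : m ^ 2 ≤ 2 * B.ncard := by
  classical
  have := Fintype.ofFinite V
  let P : Finset (Σ _ : V, V) := A.toFinset.sigma (fun a => (T a).toFinset)
  have hP : m ^ 2 ≤ P.card := by
    rw [Finset.card_sigma, sq]
    rw [Set.ncard_eq_toFinset_card'] at hA
    refine (Nat.mul_le_mul_right m hA).trans ?_
    rw [← smul_eq_mul]
    refine Finset.card_nsmul_le_sum _ _ _ fun a ha => ?_
    rw [← Set.ncard_eq_toFinset_card']
    exact hT a (Set.mem_toFinset.1 ha)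
  refine hP.trans ?_
  rw [Set.ncard_eq_toFinset_card']
  refine Finset.card_le_mul_card_image_of_maps_to (f := fun x => s(x.1, x.2)) ?_ 2 ?_
  · rintro ⟨a, b⟩ h
    simp only [P, Finset.mem_sigma, Set.mem_toFinset] at h ⊢
    exact hB a h.1 b h.2
  · intro e _
    induction e using Sym2.ind with
    | _ x y =>
      refine (Finset.card_le_card (t := {⟨x, y⟩, ⟨y, x⟩}) ?_).trans Finset.card_le_two
      rintro ⟨a, b⟩ h
      have h' := (Finset.mem_filter.1 h).2
      simp only [Sym2.eq_iff] at h'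
      rcases h' with ⟨rfl, rfl⟩ | ⟨rfl, rfl⟩ <;> simp

/-- A connected non-Hamiltonian `(R,2)`-expander has at least `R²/2`
boosters. -/
theorem stmt17 {V : Type*} [Fintype V] [DecidableEq V] (G : SimpleGraph V) (R : ℕ)
    (hR : 0 < R) (hconn : G.Connected) (hexp : IsExpander G (R : ℝ) 2)
    (hham : ¬G.IsHamiltonian) :
    (R : ℝ) ^ 2 / 2 ≤ ((boosters G).ncard : ℝ) := by
  have := hconn.nonempty
  obtain ⟨f, hf⟩ := exists_isPathSeq_maxPathLen G
  have h2 := hf.two_le hR rfl hexp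
  set n := maxPathLen G with hn
  have hends : ∀ a ∈ rotationEnds G n f, ∃ g, IsPathSeq G n g ∧ g n = a := by
    rintro a ⟨g, hg, rfl⟩
    exact ⟨_, (hf.of_rotation hg).1.reverse, by simp⟩
  choose! F hF hFn using hends
  have key := sq_le_two_mul_ncard_of_pairs (B := boosters G) (hf.lt_ncard_rotationEnds hn hexp)
    (fun a => rotationEnds G n (F a)) (fun a ha => (hF a ha).lt_ncard_rotationEnds hn hexp) (by
      rintro a ha b ⟨g, hg, rfl⟩
      obtain ⟨h3, h4, -⟩ := (hF a ha).of_rotation hg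
      have := h3.mk_mem_boosters hn h2 hconn hham
      rwa [h4, hFn a ha] at this)
  have key' : ((R : ℝ) + 1) ^ 2 ≤ 2 * ((boosters G).ncard : ℝ) := by exact_mod_cast key
  have hR0 : (0 : ℝ) ≤ R := R.cast_nonneg
  nlinarith
end
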